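/- arXiv:2204.02882 — 4 statements merged into one kernel-verified Lean document; each statement's English description precedes it below -/
import Mathlib

section
/- No tree-like continuum has a proper open meager composant: if X is a tree-like continuum and M_x is open in X, then M_x = X. -/
open Set Topology

/-- The meager composant of `x`: the union of all nowhere dense subcontinua containing `x`. -/
def MeagerComposant (X : Type) [TopologicalSpace X] (x : X) : Set X :=
  ⋃₀ {L : Set X | IsCompact L ∧ IsConnected L ∧ IsNowhereDense L ∧ x ∈ L}

/-- A continuum is hereditarily unicoherent if the intersection of any two subcontinua
is connected (possibly empty, hence preconnected). -/
def HereditarilyUnicoherent (X : Type) [TopologicalSpace X] : Prop :=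
  ∀ A B : Set X, IsCompact A → IsConnected A → IsCompact B → IsConnected B →
    IsPreconnected (A ∩ B)

/-- A subcontinuum `A` of `X` is ample if every open neighborhood of `A` contains a
subcontinuum having `A` in its interior. -/
def Ample {X : Type} [TopologicalSpace X] (A : Set X) : Prop :=
  ∀ U : Set X, IsOpen U → A ⊆ U →
    ∃ K : Set X, IsCompact K ∧ IsPreconnected K ∧ A ⊆ interior K ∧ K ⊆ U

/-- A set `C` is indecomposable if it is not the union of two proper subcontinua. -/
def IndecomposableSet {X : Type} [TopologicalSpace X] (C : Set X) : Prop :=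
  ¬ ∃ H K : Set X, IsCompact H ∧ IsConnected H ∧ IsCompact K ∧ IsConnected K ∧
    H ⊆ C ∧ K ⊆ C ∧ H ≠ C ∧ K ≠ C ∧ H ∪ K = C

/-- A dendrite: a (metrizable) locally connected continuum containing no simple closed curve. -/
def IsDendriteSpace (T : Type) [TopologicalSpace T] : Prop :=
  Nonempty T ∧ CompactSpace T ∧ ConnectedSpace T ∧ TopologicalSpace.MetrizableSpace T ∧
  LocallyConnectedSpace T ∧ ∀ S : Set T, ¬ Nonempty (S ≃ₜ Circle)

/-- A finite tree (acyclic finite graph): a dendrite with finitely many endpoints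
(equivalently, finitely many non-cut points). -/
def IsFiniteTreeSpace (T : Type) [MetricSpace T] : Prop :=
  IsDendriteSpace T ∧ {t : T | IsPreconnected ({t}ᶜ : Set T)}.Finite

/-- `X` is tree-like: for every `ε > 0` there is an `ε`-map of `X` onto a finite tree. -/
def TreeLike (X : Type) [MetricSpace X] : Prop :=
  ∀ ε : ℝ, 0 < ε → ∃ (T : Type), ∃ (_ : MetricSpace T), IsFiniteTreeSpace T ∧
    ∃ f : X → T, Continuous f ∧ Function.Surjective f ∧
      ∀ t : T, Metric.diam (f ⁻¹' {t}) < ε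


/-! ### Part 1: the argument in hereditarily unicoherent continua -/

lemma baire_rel {X : Type} [MetricSpace X] [CompactSpace X] {ι : Type} [Countable ι]
    (K O : Set X) (hK : IsClosed K) (hO : IsOpen O) (hne : (K ∩ O).Nonempty)
    (D : ι → Set X) (hD : ∀ i, IsClosed (D i)) (hcov : K ∩ O ⊆ ⋃ i, D i) :
    ∃ i, ∃ V, IsOpen V ∧ (V ∩ K).Nonempty ∧ V ∩ K ⊆ D i := by
  by_contra hcon
  push Not at hcon
  have : CompactSpace K := isCompact_iff_compactSpace.1 hK.isCompact
  have hd : Dense (⋂ i, ((↑) ⁻¹' (D i)ᶜ : Set K)) := by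
    refine dense_iInter_of_isOpen (fun i => ?_) (fun i => ?_)
    · exact (hD i).isOpen_compl.preimage continuous_subtype_val
    · rw [dense_iff_inter_open]
      rintro U hU ⟨z, hz⟩
      obtain ⟨V, hV, rfl⟩ := isOpen_induced_iff.1 hU
      have := hcon i V hV ⟨z, hz, z.2⟩
      obtain ⟨w, hw, hwD⟩ := Set.not_subset.1 this
      exact ⟨⟨w, hw.2⟩, hw.1, hwD⟩
  obtain ⟨z, hzK, hzO⟩ := hne
  obtain ⟨w, hw, hw'⟩ := hd.inter_open_nonempty (((↑) : K → X) ⁻¹' O)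
    (hO.preimage continuous_subtype_val) ⟨⟨z, hzK⟩, hzO⟩
  obtain ⟨i, hi⟩ := mem_iUnion.1 (hcov ⟨w.2, hw⟩)
  exact (mem_iInter.1 hw' i) hi

lemma isClosed_component {X : Type} [TopologicalSpace X] (F : Set X) (hF : IsClosed F) (x : X) :
    IsClosed (connectedComponentIn F x) := by
  by_cases hx : x ∈ F
  · refine isClosed_of_closure_subset ?_
    refine IsPreconnected.subset_connectedComponentIn
      (isPreconnected_connectedComponentIn.closure) ?_ ?_
    · exact subset_closure (mem_connectedComponentIn hx)
    · exact closure_minimal (connectedComponentIn_subset _ _) hF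
  · rw [connectedComponentIn_eq_empty hx]; exact isClosed_empty

/-- Complementary pieces: if `I` is connected and closed, `H ⊆ I` closed connected and nonempty,
`closure (I \ H) = P ∪ Q` with `P`, `Q` closed disjoint, then `H ∪ P` is connected. -/
lemma preconnected_union_piece {X : Type} [TopologicalSpace X] {I H P Q : Set X}
    (hI : IsPreconnected I) (hIc : IsClosed I) (hH : IsConnected H) (hHc : IsClosed H)
    (hHI : H ⊆ I) (hP : IsClosed P) (hQ : IsClosed Q) (hPQ : Disjoint P Q)
    (hPI : P ⊆ I)
    (hcov : I ⊆ H ∪ P ∪ Q) : IsPreconnected (H ∪ P) := by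
  rw [isPreconnected_iff_subset_of_fully_disjoint_closed (hHc.union hP)]
  have key : ∀ u v : Set X, IsClosed u → IsClosed v → H ∪ P ⊆ u ∪ v → Disjoint u v → H ⊆ u →
      H ∪ P ⊆ u := by
    intro u v hu hv huv hd hHu
    have h1 := (isPreconnected_iff_subset_of_fully_disjoint_closed hIc).1 hI
      (((H ∪ P) ∩ u) ∪ Q) (P ∩ v) (((hHc.union hP).inter hu).union hQ) (hP.inter hv) ?_ ?_
    · rcases h1 with h1 | h1
      · intro z hz
        rcases hz with hz | hz
        · exact hHu hz
        · rcases h1 (hPI hz) with h | h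
          · exact h.2
          · exact (Set.disjoint_left.1 hPQ hz h).elim
      · obtain ⟨z, hz⟩ := hH.nonempty
        exact (Set.disjoint_left.1 hd (hHu hz) (h1 (hHI hz)).2).elim
    · intro z hz
      rcases hcov hz with hz' | hz'
      · rcases huv hz' with h | h
        · exact Or.inl (Or.inl ⟨hz', h⟩)
        · rcases hz' with h' | h'
          · exact Or.inl (Or.inl ⟨Or.inl h', hHu h'⟩)
          · exact Or.inr ⟨h', h⟩
      · exact Or.inl (Or.inr hz')
    · rw [Set.disjoint_left]
      rintro z (hz | hz) hz'
      · exact Set.disjoint_left.1 hd hz.2 hz'.2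
      · exact Set.disjoint_left.1 hPQ hz'.1 hz
  intro u v hu hv huv hd
  rcases (isPreconnected_iff_subset_of_fully_disjoint_closed hHc).1 hH.isPreconnected u v hu hv
    (subset_union_left.trans huv) hd with h | h
  · exact Or.inl (key u v hu hv huv hd h)
  · exact Or.inr (key v u hv hu (by rwa [Set.union_comm v u]) hd.symm h)

/-- Intersection of a chain of continua is preconnected. -/
lemma chain_preconnected {X : Type} [TopologicalSpace X] [T2Space X] [CompactSpace X]
    (c : Set (Set X)) (hc : IsChain (· ⊆ ·) c) (hne : c.Nonempty)
    (hcl : ∀ s ∈ c, IsClosed s) (hconn : ∀ s ∈ c, IsPreconnected s) :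
    IsPreconnected (⋂₀ c) := by
  have hcc : IsClosed (⋂₀ c) := isClosed_sInter hcl
  rw [isPreconnected_iff_subset_of_fully_disjoint_closed hcc]
  intro u v hu hv huv hd
  obtain ⟨U, V, hU, hV, huU, hvV, hUV⟩ := normal_separation hu hv hd
  have hdir : DirectedOn (· ⊇ ·) c := by
    intro a ha b hb
    rcases hc.total ha hb with h | h
    · exact ⟨a, ha, subset_rfl, h⟩
    · exact ⟨b, hb, h, subset_rfl⟩
  have hex : ∃ s ∈ c, s ⊆ U ∪ V := by
    by_contra hcon
    push Not at hcon
    have := hne.to_subtype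
    have := IsCompact.nonempty_iInter_of_directed_nonempty_isCompact_isClosed
      (fun s : c => (s : Set X) ∩ (U ∪ V)ᶜ) ?_ ?_ ?_ ?_
    · obtain ⟨z, hz⟩ := this
      rw [mem_iInter] at hz
      have h1 : z ∈ ⋂₀ c := fun s hs => (hz ⟨s, hs⟩).1
      obtain ⟨s, hs⟩ := hne
      exact (hz ⟨s, hs⟩).2 ((huv.trans (union_subset_union huU hvV)) h1)
    · intro a b
      obtain ⟨z, hz, h1, h2⟩ := hdir a a.2 b b.2
      exact ⟨⟨z, hz⟩, inter_subset_inter_left _ h1, inter_subset_inter_left _ h2⟩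
    · intro s
      obtain ⟨z, hz, hz'⟩ := Set.not_subset.1 (hcon s s.2)
      exact ⟨z, hz, hz'⟩
    · intro s
      exact ((hcl s s.2).inter (hU.union hV).isClosed_compl).isCompact
    · intro s
      exact ((hcl s s.2).inter (hU.union hV).isClosed_compl)
  obtain ⟨s, hs, hsUV⟩ := hex
  have h2 := (isPreconnected_iff_subset_of_disjoint.1 (hconn s hs)) U V hU hV hsUV
    (by rw [hUV.inter_eq, inter_empty])
  rcases h2 with h | h
  · left
    intro z hz
    rcases huv hz with h' | h'
    · exact h'
    · exact (Set.disjoint_left.1 hUV (h (hz s hs)) (hvV h')).elim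
  · right
    intro z hz
    rcases huv hz with h' | h'
    · exact (Set.disjoint_left.1 hUV (huU h') (h (hz s hs))).elim
    · exact h'

theorem hu_main (X : Type) [MetricSpace X] [CompactSpace X] [ConnectedSpace X] [Nontrivial X]
    (hu : HereditarilyUnicoherent X) (x : X) (hopen : IsOpen (MeagerComposant X x)) :
    MeagerComposant X x = Set.univ := by
  set M := MeagerComposant X x with hM
  have hLM : ∀ L, IsClosed L → IsPreconnected L → IsNowhereDense L → x ∈ L → L ⊆ M := by
    intro L h1 h2 h3 h4
    exact subset_sUnion_of_mem ⟨h1.isCompact, ⟨⟨x, h4⟩, h2⟩, h3, h4⟩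
  by_contra hne
  -- minimal continuum containing `x` and leaving `M`
  obtain ⟨I, hImin⟩ : ∃ I, Minimal
      (fun I : Set X => IsClosed I ∧ IsPreconnected I ∧ x ∈ I ∧ (I ∩ Mᶜ).Nonempty) I := by
    have hz := zorn_superset_nonempty
      {I : Set X | IsClosed I ∧ IsPreconnected I ∧ x ∈ I ∧ (I ∩ Mᶜ).Nonempty} ?_ univ ?_
    · obtain ⟨I, -, hI⟩ := hz
      exact ⟨I, hI⟩
    · intro c hcS hc hcne
      refine ⟨⋂₀ c, ⟨isClosed_sInter fun s hs => (hcS hs).1,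
        chain_preconnected c hc hcne (fun s hs => (hcS hs).1) (fun s hs => (hcS hs).2.1),
        fun s hs => (hcS hs).2.2.1, ?_⟩, fun s hs => sInter_subset_of_mem hs⟩
      have := hcne.to_subtype
      have := IsCompact.nonempty_iInter_of_directed_nonempty_isCompact_isClosed
        (fun s : c => (s : Set X) ∩ Mᶜ) ?_ ?_ ?_ ?_
      · obtain ⟨z, hz⟩ := this
        rw [mem_iInter] at hz
        obtain ⟨s, hs⟩ := hcne
        exact ⟨z, fun s hs => (hz ⟨s, hs⟩).1, (hz ⟨s, hs⟩).2⟩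
      · intro a b
        rcases hc.total a.2 b.2 with h | h
        · exact ⟨a, subset_rfl, inter_subset_inter_left _ h⟩
        · exact ⟨b, inter_subset_inter_left _ h, subset_rfl⟩
      · intro s; exact (hcS s.2).2.2.2
      · intro s; exact ((hcS s.2).1.inter hopen.isClosed_compl).isCompact
      · intro s; exact ((hcS s.2).1.inter hopen.isClosed_compl)
    · refine ⟨isClosed_univ, isPreconnected_univ, mem_univ _, ?_⟩
      rw [univ_inter, nonempty_compl]; exact hne
  obtain ⟨⟨hIcl, hIconn, hxI, q, hqI, hqM⟩, hmin⟩ := hImin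
  have hqM' : q ∉ M := hqM
  -- a continuum in `I` through `x` and `q` is `I`
  have hirr : ∀ J, IsClosed J → IsPreconnected J → x ∈ J → J ⊆ I → ¬ J ⊆ M → I ⊆ J := by
    intro J h1 h2 h3 h4 h5
    obtain ⟨z, hz, hz'⟩ := Set.not_subset.1 h5
    exact hmin ⟨h1, h2, h3, z, hz, hz'⟩ h4
  have hpropM : ∀ J, IsClosed J → IsPreconnected J → x ∈ J → J ⊆ I → q ∉ J → J ⊆ M := by
    intro J h1 h2 h3 h4 h5
    by_contra h6
    exact h5 (hirr J h1 h2 h3 h4 h6 hqI)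
  have hirrq : ∀ J, IsClosed J → IsPreconnected J → x ∈ J → J ⊆ I → q ∈ J → I ⊆ J :=
    fun J h1 h2 h3 h4 h5 => hirr J h1 h2 h3 h4 (fun h => hqM' (h h5))
  -- points of `I ∩ M` are joined to `x` in `I ∩ M`
  have hjoin : ∀ y ∈ I ∩ M, ∃ L, IsClosed L ∧ IsPreconnected L ∧ IsNowhereDense L ∧ x ∈ L ∧
      y ∈ L ∧ L ⊆ I ∧ L ⊆ M := by
    rintro y ⟨hyI, L, ⟨hL1, hL2, hL3, hL4⟩, hyL⟩
    have hsub : L ⊆ M := hLM L hL1.isClosed hL2.isPreconnected hL3 hL4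
    refine ⟨L ∩ I, hL1.isClosed.inter hIcl, hu L I hL1 hL2 hIcl.isCompact ⟨⟨x, hxI⟩, hIconn⟩,
      hL3.mono inter_subset_left, ⟨hL4, hxI⟩, ⟨hyL, hyI⟩, inter_subset_right,
      inter_subset_left.trans hsub⟩
  have hxM : x ∈ M := by
    by_contra hxM
    refine hxM (hLM {x} isClosed_singleton isPreconnected_singleton ?_ rfl rfl)
    rw [IsNowhereDense, isClosed_singleton.closure_eq, interior_singleton]
  -- `I ∩ M` is dense in `I`
  have hdense : I ⊆ closure (I ∩ M) := by
    by_contra hcon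
    have hpc : IsPreconnected (I ∩ M) := by
      refine isPreconnected_of_forall x fun y hy => ?_
      obtain ⟨L, h1, h2, h3, h4, h5, h6, h7⟩ := hjoin y hy
      exact ⟨L, subset_inter h6 h7, h4, h5, h2⟩
    have hcI : closure (I ∩ M) ⊆ I := closure_minimal inter_subset_left hIcl
    have hcM : closure (I ∩ M) ⊆ M := by
      by_contra h
      exact hcon (hirr _ isClosed_closure hpc.closure (subset_closure ⟨hxI, hxM⟩) hcI h)
    have h1 := isPreconnected_iff_subset_of_disjoint.1 hIconn M (closure (I ∩ M))ᶜ hopen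
      isClosed_closure.isOpen_compl ?_ ?_
    · rcases h1 with h | h
      · exact hqM' (h hqI)
      · exact h hxI (subset_closure ⟨hxI, hxM⟩)
    · intro z hz
      by_cases hzM : z ∈ M
      · exact Or.inl hzM
      · exact Or.inr fun h => hzM (hcM h)
    · ext z
      simp only [mem_inter_iff, mem_compl_iff, mem_empty_iff_false, iff_false]
      rintro ⟨h1, h2, h3⟩
      exact h3 (subset_closure ⟨h1, h2⟩)
  -- complements of continua are connected
  have hcompl : ∀ H, IsClosed H → IsPreconnected H → x ∈ H → H ⊆ I → H ⊆ M →
      IsPreconnected (closure (I \ H)) := by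
    intro H h1 h2 h3 h4 h5
    have hKI : closure (I \ H) ⊆ I := closure_minimal sdiff_subset hIcl
    rw [isPreconnected_iff_subset_of_fully_disjoint_closed isClosed_closure]
    have key : ∀ u v, IsClosed u → IsClosed v → closure (I \ H) ⊆ u ∪ v → Disjoint u v →
        q ∈ u → closure (I \ H) ⊆ u := by
      intro u v hu hv huv hd hqu
      have h6 := preconnected_union_piece (H := H) (P := closure (I \ H) ∩ u)
        (Q := closure (I \ H) ∩ v) hIconn hIcl ⟨⟨x, h3⟩, h2⟩ h1 h4
        (isClosed_closure.inter hu) (isClosed_closure.inter hv)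
        (hd.mono inter_subset_right inter_subset_right)
        (inter_subset_left.trans hKI) ?_
      · have h7 : I ⊆ H ∪ (closure (I \ H) ∩ u) := by
          refine hirrq _ (h1.union (isClosed_closure.inter hu)) h6 (Or.inl h3)
            (union_subset h4 (inter_subset_left.trans hKI)) (Or.inr ⟨?_, hqu⟩)
          exact subset_closure ⟨hqI, fun h => hqM' (h5 h)⟩
        refine closure_minimal ?_ hu
        rintro z ⟨hz, hzH⟩
        rcases h7 hz with h | h
        · exact (hzH h).elim
        · exact h.2
      · intro z hz
        by_cases hzH : z ∈ H
        · exact Or.inl (Or.inl hzH)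
        · have := subset_closure (s := I \ H) ⟨hz, hzH⟩
          rcases huv this with h | h
          · exact Or.inl (Or.inr ⟨this, h⟩)
          · exact Or.inr ⟨this, h⟩
    intro u v hu hv huv hd
    have hqK : q ∈ closure (I \ H) := subset_closure ⟨hqI, fun h => hqM' (h5 h)⟩
    rcases huv hqK with h | h
    · exact Or.inl (key u v hu hv huv hd h)
    · exact Or.inr (key v u hv hu (by rwa [Set.union_comm v u]) hd.symm h)
  -- `I` has interior
  have hIint : (interior I).Nonempty := by
    rw [Set.nonempty_iff_ne_empty]
    intro h
    refine hqM' (hLM I hIcl hIconn ?_ hxI hqI)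
    rw [IsNowhereDense, hIcl.closure_eq, h]
  have hBc := TopologicalSpace.countable_countableBasis X
  let ι := {U : Set X // U ∈ TopologicalSpace.countableBasis X ∧ q ∈ U}
  have : Countable ι := by
    have : {U : Set X | U ∈ TopologicalSpace.countableBasis X ∧ q ∈ U}.Countable :=
      hBc.mono fun U hU => hU.1
    exact this.to_subtype
  have hbasis : ∀ F : Set X, IsClosed F → q ∉ F → ∃ U : ι, Disjoint F U.1 := by
    intro F hF hqF
    obtain ⟨U, hU, hqU, hUF⟩ := (TopologicalSpace.isBasis_countableBasis X).exists_subset_of_mem_open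
      (show q ∈ Fᶜ from hqF) hF.isOpen_compl
    exact ⟨⟨U, hU, hqU⟩, (disjoint_compl_right).mono_right hUF⟩
  have hUo : ∀ U : ι, IsOpen U.1 := fun U => TopologicalSpace.isOpen_of_mem_countableBasis U.2.1
  by_cases hcase : ∀ H, IsClosed H → IsPreconnected H → x ∈ H → H ⊆ I → H ⊆ M →
      ∃ H', IsClosed H' ∧ IsPreconnected H' ∧ x ∈ H' ∧ H' ⊆ I ∧ H' ⊆ M ∧
        Disjoint H (closure (I \ H'))
  · have hnd : ∀ H, IsClosed H → IsPreconnected H → x ∈ H → H ⊆ I → H ⊆ M →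
        IsNowhereDense H := by
      intro H h1 h2 h3 h4 h5
      obtain ⟨H', g1, g2, g3, g4, g5, g6⟩ := hcase H h1 h2 h3 h4 h5
      obtain ⟨y, hyH', hyI, hyM⟩ := mem_closure_iff.1 (hdense hqI) H'ᶜ g1.isOpen_compl
        (fun h => hqM' (g5 h))
      obtain ⟨L, l1, l2, l3, l4, l5, l6, l7⟩ := hjoin y ⟨hyI, hyM⟩
      have hu1 : I ⊆ L ∪ closure (I \ H') := by
        refine hirrq _ (l1.union isClosed_closure) ?_ (Or.inl l4)
          (union_subset l6 (closure_minimal sdiff_subset hIcl))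
          (Or.inr (subset_closure ⟨hqI, fun h => hqM' (g5 h)⟩))
        exact IsPreconnected.union y l5 (subset_closure ⟨hyI, hyH'⟩) l2 (hcompl H' g1 g2 g3 g4 g5)
      refine l3.mono fun z hz => ?_
      rcases hu1 (h4 hz) with h | h
      · exact h
      · exact (Set.disjoint_left.1 g6 hz h).elim
    have hbr := baire_rel (ι := ι) univ (interior I ∩ M) isClosed_univ
      (isOpen_interior.inter hopen) ?_ (fun U => connectedComponentIn (I \ U.1) x)
      (fun U => isClosed_component _ (hIcl.sdiff (hUo U)) x) ?_
    · obtain ⟨U, V, hV, hVne, hVD⟩ := hbr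
      rw [inter_univ] at hVne hVD
      have hxU : x ∈ I \ U.1 := by
        by_contra h
        rw [connectedComponentIn_eq_empty h] at hVD
        obtain ⟨z, hz⟩ := hVne
        exact hVD hz
      have hcl := isClosed_component _ (hIcl.sdiff (hUo U)) x
      have hpc := isPreconnected_connectedComponentIn (x := x) (F := I \ U.1)
      have hs := connectedComponentIn_subset (I \ U.1) x
      have := hnd _ hcl hpc (mem_connectedComponentIn hxU) (hs.trans sdiff_subset)
        (hpropM _ hcl hpc (mem_connectedComponentIn hxU) (hs.trans sdiff_subset)
          (fun h => (hs h).2 U.2.2))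
      rw [IsNowhereDense, hcl.closure_eq] at this
      obtain ⟨z, hz⟩ := hVne
      have h2 := interior_maximal hVD hV hz
      rw [this] at h2
      exact h2
    · rw [univ_inter]
      obtain ⟨z, hz⟩ := hIint
      obtain ⟨y, hy, hy'⟩ := mem_closure_iff.1 (hdense (interior_subset hz)) _ isOpen_interior hz
      exact ⟨y, hy, hy'.2⟩
    · rintro y ⟨-, hy, hyM⟩
      obtain ⟨L, l1, l2, l3, l4, l5, l6, l7⟩ := hjoin y ⟨interior_subset hy, hyM⟩
      obtain ⟨U, hU⟩ := hbasis L l1 (fun h => hqM' (l7 h))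
      refine mem_iUnion_of_mem U ?_
      change y ∈ connectedComponentIn (I \ U.1) x
      exact l2.subset_connectedComponentIn l4
        (show L ⊆ I \ U.1 from fun z hz => ⟨l6 hz, Set.disjoint_left.1 hU hz⟩) l5
  · push Not at hcase
    obtain ⟨H, h1, h2, h3, h4, h5, hH⟩ := hcase
    set K := closure (I \ H) with hK
    have hKI : K ⊆ I := closure_minimal sdiff_subset hIcl
    have hKc : IsPreconnected K := hcompl H h1 h2 h3 h4 h5
    have hqK : q ∈ K := subset_closure ⟨hqI, fun h => hqM' (h5 h)⟩
    obtain ⟨h, hhH, hhK⟩ := Set.not_disjoint_iff.1 (hH H h1 h2 h3 h4 h5)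
    have hbr := baire_rel (ι := ι) K M isClosed_closure hopen
      ⟨h, hhK, h5 hhH⟩ (fun U => connectedComponentIn (K \ U.1) h)
      (fun U => isClosed_component _ (isClosed_closure.sdiff (hUo U)) h) ?_
    · obtain ⟨U, V, hV, hVne, hVD⟩ := hbr
      have hhU : h ∈ K \ U.1 := by
        by_contra h'
        rw [connectedComponentIn_eq_empty h'] at hVD
        obtain ⟨z, hz⟩ := hVne
        exact hVD hz
      have hcl := isClosed_component _ (isClosed_closure.sdiff (hUo U) : IsClosed (K \ U.1)) h
      have hpc := isPreconnected_connectedComponentIn (x := h) (F := K \ U.1)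
      have hs := connectedComponentIn_subset (K \ U.1) h
      have hhD := mem_connectedComponentIn hhU
      set D := connectedComponentIn (K \ U.1) h with hD
      have hqD : q ∉ D := fun h' => (hs h').2 U.2.2
      have hDI : D ⊆ I := (hs.trans sdiff_subset).trans hKI
      have hqH : q ∉ H := fun h => hqM' (h5 h)
      have e1 : IsClosed (H ∪ D) := h1.union hcl
      have e2 : IsPreconnected (H ∪ D) := IsPreconnected.union h hhH hhD h2 hpc
      have e4 : H ∪ D ⊆ I := union_subset h4 hDI
      have hqHD : q ∉ H ∪ D := fun h => h.elim hqH hqD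
      have e5 : H ∪ D ⊆ M := hpropM _ e1 e2 (Or.inl h3) e4 hqHD
      obtain ⟨w, hwH, hwB⟩ := Set.not_disjoint_iff.1 (hH _ e1 e2 (Or.inl h3) e4 e5)
      have hB := hcompl _ e1 e2 (Or.inl h3) e4 e5
      have hfull : I ⊆ H ∪ closure (I \ (H ∪ D)) := by
        refine hirrq _ (h1.union isClosed_closure) (IsPreconnected.union w hwH hwB h2 hB)
          (Or.inl h3) (union_subset h4 (closure_minimal sdiff_subset hIcl))
          (Or.inr (subset_closure ⟨hqI, hqHD⟩))
      have hKB : K ⊆ closure (I \ (H ∪ D)) := by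
        refine closure_minimal ?_ isClosed_closure
        rintro z ⟨hz, hzH⟩
        exact (hfull hz).resolve_left hzH
      obtain ⟨z, hzV, hzK⟩ := hVne
      obtain ⟨y, hyV, hyI, hyHD⟩ := mem_closure_iff.1 (hKB hzK) V hV hzV
      refine hyHD (Or.inr (hVD ⟨hyV, ?_⟩))
      exact subset_closure ⟨hyI, fun h => hyHD (Or.inl h)⟩
    · rintro y ⟨hyK, hyM⟩
      obtain ⟨L, l1, l2, l3, l4, l5, l6, l7⟩ := hjoin y ⟨hKI hyK, hyM⟩
      have f1 : IsClosed ((L ∪ H) ∩ K) := (l1.union h1).inter isClosed_closure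
      have f2 : IsPreconnected ((L ∪ H) ∩ K) :=
        hu _ _ (l1.union h1).isCompact ⟨⟨x, Or.inl l4⟩, IsPreconnected.union x l4 h3 l2 h2⟩
          isClosed_closure.isCompact ⟨⟨q, hqK⟩, hKc⟩
      have f3 : q ∉ (L ∪ H) ∩ K := fun h => h.1.elim (fun h => hqM' (l7 h)) (fun h => hqM' (h5 h))
      obtain ⟨U, hU⟩ := hbasis _ f1 f3
      refine mem_iUnion_of_mem U ?_
      change y ∈ connectedComponentIn (K \ U.1) h
      exact f2.subset_connectedComponentIn ⟨Or.inr hhH, hhK⟩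
        (show (L ∪ H) ∩ K ⊆ K \ U.1 from
          fun z hz => ⟨hz.2, Set.disjoint_left.1 hU hz⟩) ⟨Or.inl l5, hyK⟩

/-! ### Part 2: from trees to tree-like continua -/

lemma split_of_not_preconnected {X : Type} [MetricSpace X] {A B : Set X}
    (hA : IsClosed A) (hB : IsClosed B) (h : ¬ IsPreconnected (A ∩ B)) :
    ∃ U V : Set X, IsOpen U ∧ IsOpen V ∧ Disjoint U V ∧ A ∩ B ⊆ U ∪ V ∧
      (A ∩ B ∩ U).Nonempty ∧ (A ∩ B ∩ V).Nonempty := by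
  rw [isPreconnected_iff_subset_of_fully_disjoint_closed (hA.inter hB)] at h
  push Not at h
  obtain ⟨u, v, hu, hv, huv, hd, h1, h2⟩ := h
  obtain ⟨U, V, hU, hV, huU, hvV, hUV⟩ := normal_separation hu hv hd
  refine ⟨U, V, hU, hV, hUV, huv.trans (union_subset_union huU hvV), ?_, ?_⟩
  · obtain ⟨z, hz, hz'⟩ := Set.not_subset.1 h2
    exact ⟨z, hz, huU ((huv hz).resolve_right hz')⟩
  · obtain ⟨z, hz, hz'⟩ := Set.not_subset.1 h1
    exact ⟨z, hz, hvV ((huv hz).resolve_left hz')⟩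

lemma exists_thick {X : Type} [MetricSpace X] [CompactSpace X] {A B O : Set X}
    (hA : IsClosed A) (hB : IsClosed B) (hAne : A.Nonempty) (hBne : B.Nonempty)
    (hO : IsOpen O) (hAB : A ∩ B ⊆ O) :
    ∃ δ, 0 < δ ∧ Metric.cthickening δ A ∩ Metric.cthickening δ B ⊆ O := by
  rcases (Oᶜ).eq_empty_or_nonempty with h | h
  · refine ⟨1, one_pos, ?_⟩
    rw [compl_empty_iff] at h
    rw [h]; exact subset_univ _
  · obtain ⟨z, hz, hmin⟩ := hO.isClosed_compl.isCompact.exists_isMinOn h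
      (f := fun z => Metric.infDist z A + Metric.infDist z B)
      ((Metric.continuous_infDist_pt A).add (Metric.continuous_infDist_pt B)).continuousOn
    have hpos : 0 < Metric.infDist z A + Metric.infDist z B := by
      by_contra hcon
      have h1 := Metric.infDist_nonneg (x := z) (s := A)
      have h2 := Metric.infDist_nonneg (x := z) (s := B)
      have h3 : Metric.infDist z A = 0 := by linarith
      have h4 : Metric.infDist z B = 0 := by linarith
      exact hz (hAB ⟨(hA.mem_iff_infDist_zero hAne).2 h3, (hB.mem_iff_infDist_zero hBne).2 h4⟩)
    refine ⟨(Metric.infDist z A + Metric.infDist z B) / 3, by positivity, ?_⟩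
    rintro w ⟨hw1, hw2⟩
    by_contra hw
    have h1 := hmin (show w ∈ Oᶜ from hw)
    simp only [mem_ofPred_eq] at h1
    rw [Metric.cthickening_eq_preimage_infEDist] at hw1 hw2
    have h2 : Metric.infDist w A ≤ (Metric.infDist z A + Metric.infDist z B) / 3 :=
      ENNReal.toReal_le_of_le_ofReal (by positivity) hw1
    have h3 : Metric.infDist w B ≤ (Metric.infDist z A + Metric.infDist z B) / 3 :=
      ENNReal.toReal_le_of_le_ofReal (by positivity) hw2
    linarith

lemma treeLike_hu (X : Type) [MetricSpace X] [CompactSpace X]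
    (hX : TreeLike X)
    (hT : ∀ (T : Type) [MetricSpace T], IsDendriteSpace T → HereditarilyUnicoherent T) :
    HereditarilyUnicoherent X := by
  intro A B hA hAc hB hBc
  by_contra hcon
  obtain ⟨U, V, hU, hV, hUV, hsub, hne1, hne2⟩ :=
    split_of_not_preconnected hA.isClosed hB.isClosed hcon
  obtain ⟨δ, hδ, hthick⟩ := exists_thick hA.isClosed hB.isClosed hAc.nonempty hBc.nonempty
    (hU.union hV) hsub
  have hF1 : IsClosed ((A ∩ Metric.cthickening δ B) ∩ Vᶜ) :=
    (hA.isClosed.inter Metric.isClosed_cthickening).inter hV.isClosed_compl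
  have hF2 : IsClosed ((A ∩ Metric.cthickening δ B) ∩ Uᶜ) :=
    (hA.isClosed.inter Metric.isClosed_cthickening).inter hU.isClosed_compl
  have hd : Disjoint ((A ∩ Metric.cthickening δ B) ∩ Vᶜ) ((A ∩ Metric.cthickening δ B) ∩ Uᶜ) := by
    rw [Set.disjoint_left]
    rintro z ⟨hz, hzV⟩ ⟨-, hzU⟩
    rcases hthick ⟨Metric.self_subset_cthickening A hz.1, hz.2⟩ with h | h
    · exact hzU h
    · exact hzV h
  obtain ⟨η, hη, hdis⟩ := hd.exists_cthickenings hF1.isCompact hF2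
  obtain ⟨T, mT, hTree, f, hf, -, hfib⟩ := hX (min δ η) (lt_min hδ hη)
  have hclose : ∀ a b, f a = f b → dist a b < min δ η := by
    intro a b hab
    refine lt_of_le_of_lt ?_ (hfib (f b))
    exact Metric.dist_le_diam_of_mem (Metric.isBounded_of_compactSpace) hab rfl
  have hconn := hT T hTree.1 (f '' A) (f '' B) (hA.image hf) (hAc.image f hf.continuousOn)
    (hB.image hf) (hBc.image f hf.continuousOn)
  rw [isPreconnected_closed_iff] at hconn
  have hres := hconn (f '' ((A ∩ Metric.cthickening δ B) ∩ Vᶜ))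
    (f '' ((A ∩ Metric.cthickening δ B) ∩ Uᶜ)) (hF1.isCompact.image hf).isClosed
    (hF2.isCompact.image hf).isClosed ?_ ?_ ?_
  · obtain ⟨t, -, ⟨a, ha, rfl⟩, ⟨b, hb, hab⟩⟩ := hres
    refine Set.disjoint_left.1 hdis (Metric.self_subset_cthickening _ ha) ?_
    refine Metric.mem_cthickening_of_dist_le a b η _ hb ?_
    exact ((hclose a b hab.symm).trans_le (min_le_right _ _)).le
  · rintro t ⟨⟨a, ha, rfl⟩, ⟨b, hb, hab⟩⟩
    have ha' : a ∈ A ∩ Metric.cthickening δ B :=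
      ⟨ha, Metric.mem_cthickening_of_dist_le a b δ _ hb
        ((hclose a b hab.symm).trans_le (min_le_left _ _)).le⟩
    by_cases haV : a ∈ V
    · exact Or.inr ⟨a, ⟨ha', Set.disjoint_right.1 hUV haV⟩, rfl⟩
    · exact Or.inl ⟨a, ⟨ha', haV⟩, rfl⟩
  · obtain ⟨z, ⟨hzA, hzB⟩, hzU⟩ := hne1
    exact ⟨f z, ⟨⟨z, hzA, rfl⟩, ⟨z, hzB, rfl⟩⟩, z,
      ⟨⟨hzA, Metric.self_subset_cthickening B hzB⟩, Set.disjoint_left.1 hUV hzU⟩, rfl⟩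
  · obtain ⟨z, ⟨hzA, hzB⟩, hzV⟩ := hne2
    exact ⟨f z, ⟨⟨z, hzA, rfl⟩, ⟨z, hzB, rfl⟩⟩, z,
      ⟨⟨hzA, Metric.self_subset_cthickening B hzB⟩, Set.disjoint_right.1 hUV hzV⟩, rfl⟩

/-! ### Part 3: simple closed curves -/

lemma circle_of_loop {T : Type} [TopologicalSpace T] [T2Space T] (f : ℝ → T)
    (hf : ContinuousOn f (Icc 0 2)) (h02 : f 0 = f 2) (hinj : InjOn f (Ico 0 2)) :
    ∃ S : Set T, Nonempty (S ≃ₜ Circle) := by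
  have : Fact ((0 : ℝ) < 2) := ⟨two_pos⟩
  have hc : Continuous (AddCircle.liftIco (2 : ℝ) 0 f) := AddCircle.liftIco_zero_continuous h02 hf
  have hi : Function.Injective (AddCircle.liftIco (2 : ℝ) 0 f) := by
    intro a b hab
    obtain ⟨s, hs, rfl⟩ : ∃ s ∈ Ico (0 : ℝ) 2, (s : AddCircle (2 : ℝ)) = a := by
      have := (AddCircle.equivIco (2 : ℝ) 0 a).2
      exact ⟨_, ⟨this.1, by linarith [this.2]⟩, AddCircle.coe_equivIco⟩
    obtain ⟨t, ht, rfl⟩ : ∃ s ∈ Ico (0 : ℝ) 2, (s : AddCircle (2 : ℝ)) = b := by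
      have := (AddCircle.equivIco (2 : ℝ) 0 b).2
      exact ⟨_, ⟨this.1, by linarith [this.2]⟩, AddCircle.coe_equivIco⟩
    rw [AddCircle.liftIco_zero_coe_apply hs, AddCircle.liftIco_zero_coe_apply ht] at hab
    rw [hinj hs ht hab]
  have he : IsEmbedding (AddCircle.liftIco (2 : ℝ) 0 f) := (hc.isClosedEmbedding hi).isEmbedding
  exact ⟨_, ⟨he.toHomeomorph.symm.trans (AddCircle.homeomorphCircle two_ne_zero)⟩⟩

/-- Two arcs on `[0,1]` meeting exactly at endpoints form a simple closed curve. -/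
lemma circle_of_two_arcs {T : Type} [TopologicalSpace T] [T2Space T] (a b : ℝ → T)
    (ha : ContinuousOn a (Icc 0 1)) (hb : ContinuousOn b (Icc 0 1))
    (hai : InjOn a (Icc 0 1)) (hbi : InjOn b (Icc 0 1)) (h0 : a 0 = b 0) (h1 : a 1 = b 1)
    (hd : ∀ s ∈ Ioo (0 : ℝ) 1, ∀ t ∈ Icc (0 : ℝ) 1, a s ≠ b t) :
    ∃ S : Set T, Nonempty (S ≃ₜ Circle) := by
  refine circle_of_loop (fun u => if u ≤ 1 then a u else b (2 - u)) ?_ ?_ ?_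
  · have hU : Icc (0 : ℝ) 2 = Icc 0 1 ∪ Icc 1 2 := (Icc_union_Icc_eq_Icc (by norm_num) (by norm_num)).symm
    rw [hU]
    refine ContinuousOn.union_of_isClosed ?_ ?_ isClosed_Icc isClosed_Icc
    · refine ha.congr fun u hu => ?_
      simp [hu.2]
    · have hb' : ContinuousOn (fun u : ℝ => b (2 - u)) (Icc 1 2) := by
        refine hb.comp (by fun_prop) fun u hu => ?_
        constructor <;> linarith [hu.1, hu.2]
      refine hb'.congr fun u hu => ?_
      rcases hu.1.eq_or_lt with h | h
      · subst h
        norm_num [h1]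
      · simp [not_le.2 h]
  · norm_num [h0]
  · have key : ∀ u v : ℝ, 0 ≤ u → u ≤ 1 → 1 < v → v < 2 → a u ≠ b (2 - v) := by
      intro u v hu0 hu1 hv1 hv2 hab
      have hv : 2 - v ∈ Icc (0 : ℝ) 1 := ⟨by linarith, by linarith⟩
      rcases hu0.eq_or_lt with h | h
      · subst h
        rw [h0] at hab
        have := hbi (by norm_num) hv hab
        linarith
      · rcases hu1.eq_or_lt with h' | h'
        · subst h'
          rw [h1] at hab
          have := hbi (by norm_num) hv hab
          linarith
        · exact hd u ⟨h, h'⟩ _ hv hab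
    intro u hu v hv huv
    simp only at huv
    split_ifs at huv with h1 h2 h2
    · exact hai ⟨hu.1, h1⟩ ⟨hv.1, h2⟩ huv
    · exact (key u v hu.1 h1 (not_le.1 h2) hv.2 huv).elim
    · exact (key v u hv.1 h2 (not_le.1 h1) hu.2 huv.symm).elim
    · push Not at h1 h2
      have := hbi (x₁ := 2 - u) (x₂ := 2 - v) ⟨by linarith [hu.2], by linarith⟩
        ⟨by linarith [hv.2], by linarith⟩ huv
      linarith

/-- Two arcs with the same endpoints, whose intersection is disconnected
by open sets separating the two endpoints, give a simple closed curve. -/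
lemma circle_of_arcs {T : Type} [TopologicalSpace T] [T2Space T] (a b : unitInterval → T)
    (ha : Continuous a) (hb : Continuous b) (hai : Function.Injective a)
    (hbi : Function.Injective b) (h0 : a 0 = b 0) (h1 : a 1 = b 1)
    (U V : Set T) (hU : IsOpen U) (hV : IsOpen V) (hUV : Disjoint U V)
    (hcov : range a ∩ range b ⊆ U ∪ V) (h0U : a 0 ∈ U) (h1V : a 1 ∈ V) :
    ∃ S : Set T, Nonempty (S ≃ₜ Circle) := by
  have hbcl : IsClosed (range b) := (isCompact_range hb).isClosed
  -- last point in `U`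
  let E : Set unitInterval := a ⁻¹' (range b ∩ Vᶜ)
  have hE : IsClosed E := (hbcl.inter hV.isClosed_compl).preimage ha
  obtain ⟨s, hsE, hs⟩ := hE.isCompact.exists_isGreatest
    ⟨0, ⟨⟨0, h0.symm⟩, Set.disjoint_left.1 hUV h0U⟩⟩
  let F : Set unitInterval := a ⁻¹' (range b ∩ Uᶜ) ∩ Ici s
  have hF : IsClosed F := ((hbcl.inter hU.isClosed_compl).preimage ha).inter isClosed_Ici
  obtain ⟨s', hsF, hs'⟩ := hF.isCompact.exists_isLeast
    ⟨1, ⟨⟨⟨1, h1.symm⟩, Set.disjoint_right.1 hUV h1V⟩, unitInterval.le_one'⟩⟩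
  obtain ⟨⟨t, ht⟩, hsV⟩ := hsE
  obtain ⟨⟨⟨t', ht'⟩, hsU⟩, hss⟩ := hsF
  have hasU : a s ∈ U := (hcov ⟨⟨s, rfl⟩, ⟨t, ht⟩⟩).resolve_right hsV
  have hne : s ≠ s' := fun h => hsU (h ▸ hasU)
  have hlt : s < s' := lt_of_le_of_ne hss hne
  have htne : t ≠ t' := fun h => hne (hai (by rw [← ht, ← ht', h]))
  have hmid : ∀ r, s < r → r < s' → a r ∉ range b := by
    intro r h1 h2 hr
    rcases hcov ⟨⟨r, rfl⟩, hr⟩ with h | h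
    · exact absurd (hs (show r ∈ E from ⟨hr, Set.disjoint_left.1 hUV h⟩)) (not_le.2 h1)
    · exact absurd (hs' (show r ∈ F from ⟨⟨hr, Set.disjoint_right.1 hUV h⟩, h1.le⟩)) (not_le.2 h2)
  have hcomb : ∀ p q : unitInterval, ∀ u : ℝ, u ∈ Icc (0 : ℝ) 1 →
      (p : ℝ) + u * (q - p) ∈ Icc (0 : ℝ) 1 := by
    intro p q u hu
    have := (convex_Icc (0 : ℝ) 1).add_smul_sub_mem p.2 q.2 hu
    simpa using this
  have hproj : ∀ (c : unitInterval → T), Continuous c → ∀ p q : unitInterval, Continuous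
      (fun u : ℝ => c (projIcc 0 1 zero_le_one ((p : ℝ) + u * (q - p)))) := by
    intro c hc p q
    exact hc.comp (continuous_projIcc.comp (by fun_prop))
  have hinj : ∀ (c : unitInterval → T), Function.Injective c → ∀ p q : unitInterval, p ≠ q →
      InjOn (fun u : ℝ => c (projIcc 0 1 zero_le_one ((p : ℝ) + u * (q - p)))) (Icc 0 1) := by
    intro c hc p q hpq u hu v hv huv
    have h1 := hc huv
    rw [projIcc_of_mem _ (hcomb p q u hu), projIcc_of_mem _ (hcomb p q v hv)] at h1
    have h2 : (p : ℝ) + u * (q - p) = p + v * (q - p) := congrArg Subtype.val h1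
    have h3 : (q : ℝ) - p ≠ 0 := fun h => hpq (Subtype.ext (by linarith))
    exact mul_right_cancel₀ h3 (by linarith)
  refine circle_of_two_arcs _ _ (hproj a ha s s').continuousOn (hproj b hb t t').continuousOn
    (hinj a hai s s' hne) (hinj b hbi t t' htne) ?_ ?_ ?_
  · simp [ht]
  · simp [ht']
  · intro u hu w hw heq
    have hm := hcomb s s' u ⟨hu.1.le, hu.2.le⟩
    have hpos : (0 : ℝ) < s' - s := sub_pos.2 hlt
    rw [projIcc_of_mem _ hm] at heq
    refine hmid ⟨_, hm⟩ ?_ ?_ ⟨_, heq.symm⟩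
    · rw [← Subtype.coe_lt_coe]
      simp only
      nlinarith [hu.1]
    · rw [← Subtype.coe_lt_coe]
      simp only
      nlinarith [hu.2]

/-! ### Part 4: paths contain arcs -/

/-- Sets of parameters that can be kept when loops are removed from a path. -/
def KeepSet {T : Type} (γ : unitInterval → T) (C : Set unitInterval) : Prop :=
  IsClosed C ∧ 0 ∈ C ∧ 1 ∈ C ∧ ∀ a ∈ C, ∀ b ∈ C, a < b → (∀ c ∈ C, ¬ (a < c ∧ c < b)) → γ a = γ b

lemma exists_minimal_keep {T : Type} [TopologicalSpace T] [T2Space T] (γ : unitInterval → T)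
    (hγ : Continuous γ) : ∃ C, Minimal (KeepSet γ) C := by
  have hz := zorn_superset_nonempty {C | KeepSet γ C} ?_ univ ?_
  · obtain ⟨C, -, hC⟩ := hz
    exact ⟨C, hC⟩
  · intro c hcS hc hcne
    refine ⟨⋂₀ c, ⟨isClosed_sInter fun s hs => (hcS hs).1, fun s hs => (hcS hs).2.1,
      fun s hs => (hcS hs).2.2.1, ?_⟩, fun s hs => sInter_subset_of_mem hs⟩
    intro a ha b hb hab hgap
    by_contra hne
    -- neighbourhoods separating the values
    obtain ⟨u, v, hu, hv, hau, hbv, huv⟩ := t2_separation hne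
    have hNa : γ ⁻¹' u ∈ 𝓝 a := (hu.preimage hγ).mem_nhds hau
    have hNb : γ ⁻¹' v ∈ 𝓝 b := (hv.preimage hγ).mem_nhds hbv
    obtain ⟨a', haa', ha'⟩ := exists_Ico_subset_of_mem_nhds hNa ⟨b, hab⟩
    obtain ⟨b', hbb', hb'⟩ := exists_Ioc_subset_of_mem_nhds hNb ⟨a, hab⟩
    -- we find a set of the chain missing the middle
    have hex : ∃ s ∈ c, ∀ z ∈ s, ¬ (a' ≤ z ∧ z ≤ b' ∧ a < z ∧ z < b) := by
      by_contra hcon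
      push Not at hcon
      have := hcne.to_subtype
      have := IsCompact.nonempty_iInter_of_directed_nonempty_isCompact_isClosed
        (fun s : c => (s : Set unitInterval) ∩ Icc a' b') ?_ ?_ ?_ ?_
      · obtain ⟨z, hz⟩ := this
        rw [mem_iInter] at hz
        obtain ⟨s, hs⟩ := hcne
        have hz' := (hz ⟨s, hs⟩).2
        exact hgap z (fun s hs => (hz ⟨s, hs⟩).1) ⟨haa'.trans_le hz'.1, hz'.2.trans_lt hbb'⟩
      · intro s t
        rcases hc.total s.2 t.2 with h | h
        · exact ⟨s, subset_rfl, inter_subset_inter_left _ h⟩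
        · exact ⟨t, inter_subset_inter_left _ h, subset_rfl⟩
      · intro s
        obtain ⟨z, hz, h⟩ := hcon s s.2
        exact ⟨z, hz, h.1, h.2.1⟩
      · intro s
        exact ((hcS s.2).1.inter isClosed_Icc).isCompact
      · intro s
        exact ((hcS s.2).1.inter isClosed_Icc)
    obtain ⟨s, hs, hsgap⟩ := hex
    have hord : a' ≤ b' := by
      by_contra hlt
      push Not at hlt
      obtain ⟨z, hz1, hz2⟩ := exists_between
        (show max a b' < min a' b from max_lt (lt_min haa' hab) (lt_min hlt hbb'))
      have h1 := ha' ⟨((le_max_left _ _).trans hz1.le), hz2.trans_le (min_le_left _ _)⟩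
      have h2 := hb' ⟨((le_max_right _ _).trans_lt hz1), hz2.le.trans (min_le_right _ _)⟩
      exact Set.disjoint_left.1 huv h1 h2
    have hscl := (hcS hs).1
    obtain ⟨e, ⟨hes, hea, hea'⟩, he⟩ := (hscl.inter (isClosed_Icc (a := a) (b := a'))).isCompact.exists_isGreatest
      ⟨a, ha s hs, le_rfl, haa'.le⟩
    obtain ⟨f, ⟨hfs, hfb', hfb⟩, hf⟩ := (hscl.inter (isClosed_Icc (a := b') (b := b))).isCompact.exists_isLeast
      ⟨b, hb s hs, hbb'.le, le_rfl⟩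
    have hea2 : e < a' := by
      refine lt_of_le_of_ne hea' fun h => ?_
      exact hsgap e hes ⟨h.ge, h.le.trans hord, h ▸ haa', (h.le.trans hord).trans_lt hbb'⟩
    have hfb2 : b' < f := by
      refine lt_of_le_of_ne hfb' fun h => ?_
      exact hsgap f hfs ⟨hord.trans h.le, h.ge, haa'.trans_le (hord.trans h.le), h ▸ hbb'⟩
    have hef := (hcS hs).2.2.2 e hes f hfs (hea2.trans_le (hord.trans hfb2.le)) ?_
    · have h1 := ha' ⟨hea, hea2⟩
      have h2 := hb' ⟨hfb2, hfb⟩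
      refine Set.disjoint_left.1 huv h1 ?_
      rw [hef]; exact h2
    · rintro z hz ⟨h1, h2⟩
      by_cases hza : z ≤ a'
      · exact absurd (he ⟨hz, hea.trans h1.le, hza⟩) (not_le.2 h1)
      · by_cases hzb : b' ≤ z
        · exact absurd (hf ⟨hz, hzb, h2.le.trans hfb⟩) (not_le.2 h2)
        · push Not at hza hzb
          exact hsgap z hz ⟨hza.le, hzb.le, haa'.trans hza, hzb.trans hbb'⟩
  · refine ⟨isClosed_univ, mem_univ _, mem_univ _, ?_⟩
    intro a _ b _ hab h
    obtain ⟨c, hc⟩ := exists_between hab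
    exact (h c (mem_univ _) hc).elim

lemma exists_monotone_path {T : Type} [TopologicalSpace T] [T2Space T]
    (γ : unitInterval → T) (hγ : Continuous γ) :
    ∃ δ : unitInterval → T, Continuous δ ∧ δ 0 = γ 0 ∧ δ 1 = γ 1 ∧ range δ ⊆ range γ ∧
      ∀ s t u, s ≤ u → u ≤ t → δ s = δ t → δ u = δ s := by
  obtain ⟨C, ⟨hCcl, hC0, hC1, hC⟩, hmin⟩ := exists_minimal_keep γ hγ
  -- `near t c`: no point of `C` strictly between `t` and `c`
  let near : unitInterval → unitInterval → Prop := fun t c =>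
    c ∈ C ∧ ∀ d ∈ C, ¬ (t < d ∧ d < c) ∧ ¬ (c < d ∧ d < t)
  have hadj : ∀ a ∈ C, ∀ b ∈ C, (∀ d ∈ C, ¬ (a < d ∧ d < b)) → a ≤ b → γ a = γ b := by
    intro a ha b hb h hab
    rcases hab.eq_or_lt with h' | h'
    · rw [h']
    · exact hC a ha b hb h' h
  have hnear_uniq : ∀ t c c', near t c → near t c' → c ≤ c' → γ c = γ c' := by
    rintro t c c' ⟨hc, h1⟩ ⟨hc', h2⟩ hcc
    by_cases htC : t ∈ C
    · have key : ∀ e, near t e → γ e = γ t := by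
        rintro e ⟨he, h⟩
        rcases le_total e t with h' | h'
        · exact hadj e he t htC (fun d hd => (h d hd).2) h'
        · exact (hadj t htC e he (fun d hd => (h d hd).1) h').symm
      rw [key c ⟨hc, h1⟩, key c' ⟨hc', h2⟩]
    · refine hadj c hc c' hc' ?_ hcc
      rintro d hd ⟨h3, h4⟩
      rcases lt_trichotomy d t with h | h | h
      · exact (h1 d hd).2 ⟨h3, h⟩
      · exact htC (h ▸ hd)
      · exact (h2 d hd).1 ⟨h, h4⟩
  have hnear_uniq' : ∀ t c c', near t c → near t c' → γ c = γ c' := by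
    intro t c c' h1 h2
    rcases le_total c c' with h | h
    · exact hnear_uniq t c c' h1 h2 h
    · exact (hnear_uniq t c' c h2 h1 h).symm
  have hr : ∀ t, ∃ c, c ∈ C ∧ c ≤ t ∧ ∀ d ∈ C, d ≤ t → d ≤ c := by
    intro t
    obtain ⟨c, ⟨hc, hct⟩, h⟩ := (hCcl.inter (isClosed_Iic (a := t))).isCompact.exists_isGreatest
      ⟨0, hC0, unitInterval.nonneg'⟩
    exact ⟨c, hc, hct, fun d hd hdt => h ⟨hd, hdt⟩⟩
  choose r hrC hrle hrmax using hr
  have hrnear : ∀ t, near t (r t) := by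
    intro t
    refine ⟨hrC t, fun d hd => ⟨?_, ?_⟩⟩
    · rintro ⟨h1, h2⟩
      exact absurd (h2.trans_le (hrle t)) (not_lt.2 h1.le)
    · rintro ⟨h1, h2⟩
      exact absurd (hrmax t d hd h2.le) (not_le.2 h1)
  have hrself : ∀ t ∈ C, r t = t := fun t ht => le_antisymm (hrle t) (hrmax t t ht le_rfl)
  have hrmono : Monotone r := fun s t hst => hrmax t _ (hrC s) ((hrle s).trans hst)
  refine ⟨γ ∘ r, ?_, ?_, ?_, ?_, ?_⟩
  · -- closed graph
    rw [continuous_iff_isClosed]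
    intro Z hZ
    have hcl : IsClosed {w : unitInterval × unitInterval | near w.1 w.2} := by
      have : {w : unitInterval × unitInterval | near w.1 w.2} =
          (Prod.snd ⁻¹' C) ∩ ⋂ d ∈ C, ({w : unitInterval × unitInterval | w.1 < d ∧ d < w.2}ᶜ ∩
            {w : unitInterval × unitInterval | w.2 < d ∧ d < w.1}ᶜ) := by
        ext w
        simp [near]
      rw [this]
      refine (hCcl.preimage continuous_snd).inter (isClosed_biInter fun d _ => ?_)
      refine IsClosed.inter (IsOpen.isClosed_compl ?_) (IsOpen.isClosed_compl ?_)
      · exact (isOpen_Iio.preimage continuous_fst).inter (isOpen_Ioi.preimage continuous_snd)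
      · exact (isOpen_Iio.preimage continuous_snd).inter (isOpen_Ioi.preimage continuous_fst)
    have heq : (γ ∘ r) ⁻¹' Z = Prod.fst ''
        ({w : unitInterval × unitInterval | near w.1 w.2} ∩ (γ ∘ Prod.snd) ⁻¹' Z) := by
      ext t
      constructor
      · intro ht
        exact ⟨(t, r t), ⟨hrnear t, ht⟩, rfl⟩
      · rintro ⟨⟨t', c⟩, ⟨h1, h2⟩, rfl⟩
        change γ (r t') ∈ Z
        rw [hnear_uniq' t' (r t') c (hrnear t') h1]
        exact h2
    rw [heq]
    exact ((hcl.inter (hZ.preimage (hγ.comp continuous_snd))).isCompact.image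
      continuous_fst).isClosed
  · simp [hrself 0 hC0]
  · simp [hrself 1 hC1]
  · rintro _ ⟨t, rfl⟩
    exact ⟨r t, rfl⟩
  · intro s t u hsu hut hst
    simp only [Function.comp] at hst ⊢
    -- by minimality nothing of `C` lies strictly between `r s` and `r t`
    have hgap : ∀ d ∈ C, ¬ (r s < d ∧ d < r t) := by
      rintro d hd ⟨h1, h2⟩
      have hkeep : KeepSet γ (C \ Ioo (r s) (r t)) := by
        refine ⟨hCcl.sdiff isOpen_Ioo, ⟨hC0, ?_⟩, ⟨hC1, ?_⟩, ?_⟩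
        · rintro ⟨h, -⟩
          exact absurd h (not_lt.2 unitInterval.nonneg')
        · rintro ⟨-, h⟩
          exact absurd h (not_lt.2 unitInterval.le_one')
        · rintro a ⟨haC, ha⟩ b ⟨hbC, hb⟩ hab hno
          by_cases hcase : ∃ e ∈ C, a < e ∧ e < b
          · obtain ⟨e, heC, hae, heb⟩ := hcase
            have he : e ∈ Ioo (r s) (r t) := by
              by_contra he
              exact hno e ⟨heC, he⟩ ⟨hae, heb⟩
            have hsa : a = r s := by
              rcases lt_trichotomy a (r s) with h | h | h
              · exact (hno (r s) ⟨hrC s, fun h => lt_irrefl _ h.1⟩ ⟨h, he.1.trans heb⟩).elim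
              · exact h
              · exact (ha ⟨h, hae.trans he.2⟩).elim
            have htb : b = r t := by
              rcases lt_trichotomy b (r t) with h | h | h
              · exact (hb ⟨he.1.trans heb, h⟩).elim
              · exact h
              · exact (hno (r t) ⟨hrC t, fun h => lt_irrefl _ h.2⟩ ⟨hae.trans he.2, h⟩).elim
            rw [hsa, htb, hst]
          · push Not at hcase
            exact hC a haC b hbC hab fun e he h => absurd h.2 (not_lt.2 (hcase e he h.1))
      exact (hmin hkeep sdiff_subset hd).2 ⟨h1, h2⟩
    have h1 := hrmono hsu
    have h2 := hrmono hut
    rcases h1.eq_or_lt with h | h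
    · rw [h]
    · rcases h2.eq_or_lt with h' | h'
      · rw [h', hst]
      · exact (hgap _ (hrC u) ⟨h, h'⟩).elim

lemma exists_arc {T : Type} [MetricSpace T] [CompactSpace T]
    (γ : unitInterval → T) (hγ : Continuous γ) (hne : γ 0 ≠ γ 1) :
    ∃ α : unitInterval → T, Continuous α ∧ Function.Injective α ∧ α 0 = γ 0 ∧ α 1 = γ 1 ∧
      range α ⊆ range γ := by
  obtain ⟨δ, hδ, hδ0, hδ1, hδr, hmono⟩ := exists_monotone_path γ hγ
  let D : ℕ → unitInterval := TopologicalSpace.denseSeq unitInterval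
  let F : ℕ → unitInterval → unitInterval → ℝ := fun n t u =>
    dist (δ (D n)) (δ (max (D n) (min u t)))
  let M : ℕ → unitInterval → ℝ := fun n t => sSup (F n t '' univ)
  have hbd : ∀ x y : T, dist x y ≤ Metric.diam (univ : Set T) := fun x y =>
    Metric.dist_le_diam_of_mem Metric.isBounded_of_compactSpace (mem_univ _) (mem_univ _)
  have hbdd : ∀ n t, BddAbove (F n t '' univ) := by
    intro n t
    refine ⟨Metric.diam (univ : Set T), ?_⟩
    rintro _ ⟨u, -, rfl⟩
    exact hbd _ _
  have hMc : ∀ n, Continuous (M n) := by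
    intro n
    refine isCompact_univ.continuous_sSup ?_
    have : Continuous fun w : unitInterval × unitInterval =>
        dist (δ (D n)) (δ (max (D n) (min w.2 w.1))) :=
      continuous_const.dist (hδ.comp (continuous_const.max (continuous_snd.min continuous_fst)))
    exact this
  have hM0 : ∀ n t, 0 ≤ M n t := by
    intro n t
    exact dist_nonneg.trans (le_csSup (hbdd n t) ⟨t, mem_univ _, rfl⟩)
  have hMle : ∀ n t, M n t ≤ Metric.diam (univ : Set T) := by
    intro n t
    refine csSup_le ⟨_, ⟨t, mem_univ _, rfl⟩⟩ ?_
    rintro _ ⟨u, -, rfl⟩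
    exact hbd _ _
  have hMmono : ∀ n, Monotone (M n) := by
    intro n s t hst
    refine csSup_le ⟨_, ⟨t, mem_univ _, rfl⟩⟩ ?_
    rintro _ ⟨u, -, rfl⟩
    refine le_csSup (hbdd n t) ⟨min u s, mem_univ _, ?_⟩
    simp only [F, min_assoc, min_eq_left hst]
  have hMconst : ∀ n s t, s ≤ t → δ s = δ t → M n t ≤ M n s := by
    intro n s t hst hδst
    refine csSup_le ⟨_, ⟨t, mem_univ _, rfl⟩⟩ ?_
    rintro _ ⟨u, -, rfl⟩
    refine le_csSup (hbdd n s) ⟨u, mem_univ _, ?_⟩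
    have : δ (max (D n) (min u s)) = δ (max (D n) (min u t)) := by
      rcases le_total u s with h | h
      · rw [min_eq_left h, min_eq_left (h.trans hst)]
      · rw [min_eq_right h]
        have h1 : s ≤ min u t := le_min h hst
        have h2 : min u t ≤ t := min_le_right _ _
        rcases le_total (D n) (min u t) with h3 | h3
        · rw [max_eq_right h3, hmono s t _ h1 h2 hδst]
          exact hmono s t _ (le_max_right _ _) (max_le (h3.trans h2) hst) hδst
        · rw [max_eq_left h3, max_eq_left (h1.trans h3)]
    simp only [F, this]
  have hstrict : ∀ s t, s ≤ t → δ s ≠ δ t → ∃ n, M n s < M n t := by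
    intro s t hst hδst
    have hlt : s < t := lt_of_le_of_ne hst fun h => hδst (by rw [h])
    have hN : {z | δ z ≠ δ t} ∈ 𝓝 s :=
      (isOpen_ne_fun hδ continuous_const).mem_nhds hδst
    obtain ⟨s', hss', hs'⟩ := exists_Ico_subset_of_mem_nhds hN ⟨t, hlt⟩
    obtain ⟨z, hz, n, rfl⟩ := (TopologicalSpace.denseRange_denseSeq unitInterval).inter_open_nonempty
      (Ioo s (min s' t)) isOpen_Ioo (nonempty_Ioo.2 (lt_min hss' hlt))
    refine ⟨n, ?_⟩
    have hz1 : s < D n := hz.1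
    have hz2 : D n < s' := hz.2.trans_le (min_le_left _ _)
    have hz3 : D n < t := hz.2.trans_le (min_le_right _ _)
    have hMs : M n s ≤ 0 := by
      refine csSup_le ⟨_, ⟨t, mem_univ _, rfl⟩⟩ ?_
      rintro _ ⟨u, -, rfl⟩
      simp only [F]
      rw [max_eq_left ((min_le_right _ _).trans hz1.le), dist_self]
    have hMt : dist (δ (D n)) (δ t) ≤ M n t := by
      refine le_csSup (hbdd n t) ⟨t, mem_univ _, ?_⟩
      simp only [F, min_self, max_eq_right hz3.le]
    have hpos : 0 < dist (δ (D n)) (δ t) := dist_pos.2 (hs' ⟨hz1.le, hz2⟩)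
    linarith
  have hsum : Summable fun n : ℕ => (1 / 2 : ℝ) ^ n * Metric.diam (univ : Set T) :=
    summable_geometric_two.mul_right _
  have hnorm : ∀ n t, ‖(1 / 2 : ℝ) ^ n * M n t‖ ≤ (1 / 2 : ℝ) ^ n * Metric.diam (univ : Set T) := by
    intro n t
    rw [Real.norm_of_nonneg (mul_nonneg (by positivity) (hM0 n t))]
    exact mul_le_mul_of_nonneg_left (hMle n t) (by positivity)
  have hsumt : ∀ t, Summable fun n : ℕ => (1 / 2 : ℝ) ^ n * M n t := fun t =>
    Summable.of_norm_bounded hsum fun n => hnorm n t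
  let g : unitInterval → ℝ := fun t => ∑' n : ℕ, (1 / 2 : ℝ) ^ n * M n t
  have hgc : Continuous g := continuous_tsum (fun n => continuous_const.mul (hMc n)) hsum hnorm
  have hgle : ∀ s t, (∀ n, M n s ≤ M n t) → g s ≤ g t := fun s t h =>
    Summable.tsum_le_tsum (fun n => mul_le_mul_of_nonneg_left (h n) (by positivity))
      (hsumt s) (hsumt t)
  have hgmono : Monotone g := fun s t hst => hgle s t fun n => hMmono n hst
  have hgiff' : ∀ s t, s ≤ t → (g s = g t ↔ δ s = δ t) := by
    intro s t hst
    constructor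
    · intro h
      by_contra hcon
      obtain ⟨n, hn⟩ := hstrict s t hst hcon
      have : g s < g t := Summable.tsum_lt_tsum (i := n)
        (fun n => mul_le_mul_of_nonneg_left (hMmono n hst) (by positivity))
        (mul_lt_mul_of_pos_left hn (by positivity)) (hsumt s) (hsumt t)
      exact this.ne h
    · intro h
      exact le_antisymm (hgmono hst) (hgle t s fun n => hMconst n s t hst h)
  have hgiff : ∀ s t, g s = g t ↔ δ s = δ t := by
    intro s t
    rcases le_total s t with h | h
    · exact hgiff' s t h
    · rw [eq_comm, hgiff' t s h, eq_comm]
  have hg01 : 0 < g 1 - g 0 := by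
    have h1 : g 0 ≤ g 1 := hgmono unitInterval.nonneg'
    have h2 : g 0 ≠ g 1 := fun h => hne (by rw [← hδ0, ← hδ1, (hgiff 0 1).1 h])
    exact sub_pos.2 (lt_of_le_of_ne h1 h2)
  let k : unitInterval → unitInterval := fun t => ⟨(g t - g 0) / (g 1 - g 0),
    div_nonneg (sub_nonneg.2 (hgmono unitInterval.nonneg')) hg01.le,
    (div_le_one hg01).2 (sub_le_sub_right (hgmono unitInterval.le_one') _)⟩
  have hkc : Continuous k := Continuous.subtype_mk ((hgc.sub continuous_const).div_const _) _
  have hk0 : k 0 = 0 := Subtype.ext (by simp [k])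
  have hk1 : k 1 = 1 := Subtype.ext (by simp [k, hg01.ne'])
  have hkiff : ∀ s t, k s = k t ↔ δ s = δ t := by
    intro s t
    rw [← hgiff, Subtype.ext_iff]
    change (g s - g 0) / (g 1 - g 0) = (g t - g 0) / (g 1 - g 0) ↔ _
    rw [div_left_inj' hg01.ne', sub_left_inj]
  have hksurj : Function.Surjective k := by
    intro y
    have := intermediate_value_univ (0 : unitInterval) 1 hkc
    rw [hk0, hk1] at this
    exact this ⟨unitInterval.nonneg', unitInterval.le_one'⟩
  have hq : IsQuotientMap k := hkc.isClosedMap.isQuotientMap hkc hksurj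
  choose j hj using hksurj
  have hjk : ∀ t, δ (j (k t)) = δ t := fun t => (hkiff _ _).1 (hj _)
  refine ⟨δ ∘ j, ?_, ?_, ?_, ?_, ?_⟩
  · rw [hq.continuous_iff]
    have : (δ ∘ j) ∘ k = δ := funext hjk
    rw [this]; exact hδ
  · intro a b hab
    have := (hkiff (j a) (j b)).2 hab
    rwa [hj, hj] at this
  · have := hjk 0
    rw [hk0] at this
    exact this.trans hδ0
  · have := hjk 1
    rw [hk1] at this
    exact this.trans hδ1
  · rintro _ ⟨t, rfl⟩
    exact hδr ⟨_, rfl⟩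

/-! ### Part 6: locally connected compact metric spaces have enough paths -/

/-- A link: a connected open set with two points in it. -/
structure Link (T : Type) [TopologicalSpace T] where
  x : T
  y : T
  W : Set T
  openW : IsOpen W
  connW : IsPreconnected W
  hx : x ∈ W
  hy : y ∈ W

/-- `y` is reachable from `x` by small connected open sets inside `W`. -/
lemma exists_link_chain {T : Type} [MetricSpace T] [LocallyConnectedSpace T] (ε : ℝ) (hε : 0 < ε)
    (l : Link T) : ∃ (c : ℕ → Link T) (N : ℕ), (c 0).x = l.x ∧ (∀ n, (c n).y = (c (n + 1)).x) ∧
      (∀ n, N ≤ n → (c n).x = l.y) ∧ (∀ n, (c n).W ⊆ l.W) ∧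
      ∀ n, ∀ a ∈ (c n).W, ∀ b ∈ (c n).W, dist a b < ε := by
  -- small links around points
  have hsmall : ∀ z ∈ l.W, ∃ V : Set T, IsOpen V ∧ IsPreconnected V ∧ z ∈ V ∧ V ⊆ l.W ∧
      ∀ a ∈ V, ∀ b ∈ V, dist a b < ε := by
    intro z hz
    have hO : IsOpen (l.W ∩ Metric.ball z (ε / 2)) := l.openW.inter Metric.isOpen_ball
    have hzO : z ∈ l.W ∩ Metric.ball z (ε / 2) := ⟨hz, Metric.mem_ball_self (by positivity)⟩
    refine ⟨connectedComponentIn (l.W ∩ Metric.ball z (ε / 2)) z, hO.connectedComponentIn,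
      isPreconnected_connectedComponentIn, mem_connectedComponentIn hzO,
      (connectedComponentIn_subset _ _).trans inter_subset_left, ?_⟩
    intro a ha b hb
    have ha' := (connectedComponentIn_subset _ _ ha).2
    have hb' := (connectedComponentIn_subset _ _ hb).2
    rw [Metric.mem_ball] at ha' hb'
    have := dist_triangle_right a b z
    linarith
  let R : Set T := {z | ∃ (c : ℕ → Link T) (N : ℕ), (c 0).x = l.x ∧
    (∀ n, (c n).y = (c (n + 1)).x) ∧
      (∀ n, N ≤ n → (c n).x = z) ∧ (∀ n, (c n).W ⊆ l.W) ∧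
      ∀ n, ∀ a ∈ (c n).W, ∀ b ∈ (c n).W, dist a b < ε}
  have hstep : ∀ V : Set T, IsOpen V → IsPreconnected V → V ⊆ l.W →
      (∀ a ∈ V, ∀ b ∈ V, dist a b < ε) → ∀ z ∈ V, z ∈ R → ∀ w ∈ V, w ∈ R := by
    rintro V hV hVc hVW hVε z hz ⟨c, N, h0, h1, h2, h3, h4⟩ w hw
    refine ⟨fun n => if n < N then c n else if n = N then ⟨z, w, V, hV, hVc, hz, hw⟩ else
      ⟨w, w, V, hV, hVc, hw, hw⟩, N + 1, ?_, ?_, ?_, ?_, ?_⟩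
    · rcases Nat.eq_zero_or_pos N with h | h
      · subst h
        simp only [lt_irrefl, if_false, if_true]
        rw [← h0, h2 0 le_rfl]
      · simp only [h, if_true, h0]
    · intro n
      rcases lt_trichotomy (n + 1) N with h | h | h
      · simp only [h, (Nat.lt_succ_self n).trans h, if_true, h1]
      · subst h
        simp only [Nat.lt_succ_self, if_true, lt_irrefl, if_false]
        rw [h1, h2 _ le_rfl]
      · have e1 : ¬ n < N := by omega
        have e2 : ¬ n + 1 < N := by omega
        have e3 : n + 1 ≠ N := by omega
        simp only [e1, e2, e3, if_false]
        split_ifs <;> rfl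
    · intro n hn
      have e1 : ¬ n < N := by omega
      have e3 : n ≠ N := by omega
      simp only [e1, e3, if_false]
    · intro n
      simp only
      split_ifs
      · exact h3 n
      · exact hVW
      · exact hVW
    · intro n
      simp only
      split_ifs
      · exact h4 n
      · exact hVε
      · exact hVε
  have hxR : l.x ∈ R := by
    obtain ⟨V, hV, hVc, hz, hVW, hVε⟩ := hsmall l.x l.hx
    exact ⟨fun _ => ⟨l.x, l.x, V, hV, hVc, hz, hz⟩, 0, rfl, fun _ => rfl, fun _ _ => rfl,
      fun _ => hVW, fun _ => hVε⟩
  -- `R ∩ W` and `W \ R` are open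
  let O1 : Set T := ⋃₀ {V | IsOpen V ∧ V ⊆ l.W ∧ V ⊆ R}
  let O2 : Set T := ⋃₀ {V | IsOpen V ∧ V ⊆ l.W ∧ V ⊆ Rᶜ}
  have hcov : l.W ⊆ O1 ∪ O2 := by
    intro z hz
    obtain ⟨V, hV, hVc, hzV, hVW, hVε⟩ := hsmall z hz
    by_cases hzR : z ∈ R
    · exact Or.inl ⟨V, ⟨hV, hVW, fun w hw => hstep V hV hVc hVW hVε z hzV hzR w hw⟩, hzV⟩
    · exact Or.inr ⟨V, ⟨hV, hVW, fun w hw hwR => hzR (hstep V hV hVc hVW hVε w hw hwR z hzV)⟩, hzV⟩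
  have hO1R : O1 ⊆ R := sUnion_subset fun V hV => hV.2.2
  have hO2R : O2 ⊆ Rᶜ := sUnion_subset fun V hV => hV.2.2
  have hsplit := isPreconnected_iff_subset_of_disjoint.1 l.connW O1 O2
    (isOpen_sUnion fun V hV => hV.1) (isOpen_sUnion fun V hV => hV.1) hcov ?_
  · rcases hsplit with h | h
    · exact hO1R (h l.hy)
    · exact (hO2R (h l.hx) hxR).elim
  · ext z
    simp only [mem_inter_iff, mem_empty_iff_false, iff_false]
    rintro ⟨-, h1, h2⟩
    exact hO2R h2 (hO1R h1)

set_option maxHeartbeats 2000000 in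
lemma exists_path_in_closure {T : Type} [MetricSpace T] [CompactSpace T] [LocallyConnectedSpace T]
    (l : Link T) : ∃ γ : unitInterval → T, Continuous γ ∧ γ 0 = l.x ∧ γ 1 = l.y ∧
      range γ ⊆ closure l.W := by
  choose sub len hs0 hs1 hs2 hs3 hs4 using
    fun k : ℕ => exists_link_chain (T := T) ((1 / 2 : ℝ) ^ k) (by positivity)
  -- stages: number of pieces and pieces
  let nn : ℕ → ℕ → (ℕ → Link T) → ℕ := fun k N c => (Finset.range N).sup (fun i => len k (c i)) + 1
  let st : ℕ → ℕ × (ℕ → Link T) := fun k => Nat.rec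
    (1, fun i => if i = 0 then l else ⟨l.y, l.y, l.W, l.openW, l.connW, l.hy, l.hy⟩)
    (fun k p => (nn k p.1 p.2 * p.1, fun m => sub k (p.2 (m / nn k p.1 p.2)) (m % nn k p.1 p.2))) k
  let N : ℕ → ℕ := fun k => (st k).1
  let c : ℕ → ℕ → Link T := fun k => (st k).2
  let d : ℕ → ℕ := fun k => nn k (N k) (c k)
  have hN0 : N 0 = 1 := rfl
  have hNs : ∀ k, N (k + 1) = d k * N k := fun k => rfl
  have hcs : ∀ k m, c (k + 1) m = sub k (c k (m / d k)) (m % d k) := fun k m => rfl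
  have hdpos : ∀ k, 0 < d k := fun k => Nat.succ_pos _
  have hdlen : ∀ k i, i < N k → len k (c k i) < d k := by
    intro k i hi
    exact Nat.lt_succ_of_le (Finset.le_sup (f := fun i => len k (c k i)) (Finset.mem_range.2 hi))
  have hNpos : ∀ k, 0 < N k := by
    intro k
    induction k with
    | zero => rw [hN0]; exact one_pos
    | succ k ih => rw [hNs]; exact Nat.mul_pos (hdpos k) ih
  have hW : ∀ k i, (c k i).W ⊆ l.W := by
    intro k
    induction k with
    | zero =>
      intro i
      change (if i = 0 then l else _).W ⊆ l.W
      split_ifs <;> exact subset_rfl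
    | succ k ih =>
      intro i
      rw [hcs]
      exact (hs3 _ _ _).trans (ih _)
  have hstart : ∀ k, (c k 0).x = l.x := by
    intro k
    induction k with
    | zero => rfl
    | succ k ih => rw [hcs, Nat.zero_div, Nat.zero_mod, hs0, ih]
  have hend : ∀ k, (c k (N k)).x = l.y := by
    intro k
    induction k with
    | zero => rfl
    | succ k ih =>
      rw [hcs, hNs, Nat.mul_div_cancel_left _ (hdpos k), Nat.mul_mod_right, hs0, ih]
  have hcons : ∀ k i, i < N k → (c k i).y = (c k (i + 1)).x := by
    intro k
    induction k with
    | zero =>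
      intro i hi
      have : i = 0 := by rw [hN0] at hi; omega
      subst this
      rfl
    | succ k ih =>
      intro m hm
      have hmk : m / d k < N k := by
        rw [Nat.div_lt_iff_lt_mul (hdpos k), mul_comm]; rwa [hNs] at hm
      have hmod := Nat.mod_lt m (hdpos k)
      rw [hcs, hcs, hs1]
      by_cases hlast : m % d k + 1 = d k
      · have h1 : (m + 1) / d k = m / d k + 1 := by
          have := Nat.div_add_mod m (d k)
          have e : m + 1 = d k * (m / d k + 1) := by
            rw [Nat.mul_add, mul_one]; omega
          rw [e, Nat.mul_div_cancel_left _ (hdpos k)]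
        have h2 : (m + 1) % d k = 0 := by
          have := Nat.div_add_mod m (d k)
          have e : m + 1 = d k * (m / d k + 1) := by
            rw [Nat.mul_add, mul_one]; omega
          rw [e, Nat.mul_mod_right]
        rw [h1, h2, hs0, ← ih _ hmk, hlast]
        exact hs2 k _ _ (hdlen k _ hmk).le
      · have hlt : m % d k + 1 < d k := by omega
        have e : m + 1 = (m % d k + 1) + d k * (m / d k) := by
          have := Nat.div_add_mod m (d k); omega
        have h1 : (m + 1) / d k = m / d k := by
          rw [e, Nat.add_mul_div_left _ _ (hdpos k), Nat.div_eq_of_lt hlt, zero_add]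
        have h2 : (m + 1) % d k = m % d k + 1 := by
          conv_lhs => rw [e]
          rw [Nat.add_mul_mod_self_left, Nat.mod_eq_of_lt hlt]
        rw [h1, h2]
  have hdiam : ∀ k i, ∀ a ∈ (c (k + 1) i).W, ∀ b ∈ (c (k + 1) i).W, dist a b < (1 / 2 : ℝ) ^ k := by
    intro k i
    rw [hcs]
    exact hs4 k _ _
  -- step functions
  let ix : ℕ → unitInterval → ℕ := fun k t => ⌊(t : ℝ) * N k⌋₊
  let g : ℕ → unitInterval → T := fun k t => (c k (ix k t)).x
  have hix : ∀ k t, ix k t = ix (k + 1) t / d k := by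
    intro k t
    simp only [ix]
    have hd : (0 : ℝ) < d k := by exact_mod_cast hdpos k
    rw [← Nat.floor_div_natCast]
    congr 1
    rw [hNs]
    push_cast
    field_simp
  have hixle : ∀ k t, ix k t ≤ N k := by
    intro k t
    refine Nat.floor_le_of_le ?_
    have := t.2.2
    nlinarith [(Nat.cast_nonneg (N k) : (0 : ℝ) ≤ N k)]
  have hgmem : ∀ k t, g (k + 1) t ∈ (c k (ix k t)).W := by
    intro k t
    rw [hix]
    simp only [g]
    rw [hcs]
    exact hs3 _ _ _ (sub k _ _).hx
  have hgdist : ∀ t k, dist (g (k + 1) t) (g (k + 1 + 1) t) ≤ 1 * (1 / 2 : ℝ) ^ k := by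
    intro t k
    have := hdiam k (ix (k + 1) t) _ (c (k + 1) (ix (k + 1) t)).hx _ (hgmem (k + 1) t)
    rw [one_mul]
    exact this.le
  have hlim : ∀ t, ∃ z, Filter.Tendsto (fun k => g (k + 1) t) Filter.atTop (𝓝 z) := by
    intro t
    exact cauchySeq_tendsto_of_complete
      (cauchySeq_of_le_geometric (1 / 2) 1 (by norm_num) (hgdist t))
  choose γ hγ using hlim
  have hclose : ∀ t k, dist (g (k + 1) t) (γ t) ≤ 2 * (1 / 2 : ℝ) ^ k := by
    intro t k
    have := dist_le_of_le_geometric_of_tendsto (1 / 2) 1 (by norm_num) (hgdist t) (hγ t) k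
    refine this.trans (le_of_eq ?_)
    ring
  -- neighbouring indices give close values
  have hnb : ∀ k s t, ix (k + 1) s ≤ ix (k + 1) t → ix (k + 1) t ≤ ix (k + 1) s + 1 →
      dist (g (k + 1) s) (g (k + 1) t) ≤ (1 / 2 : ℝ) ^ k := by
    intro k s t h1 h2
    rcases Nat.eq_or_lt_of_le h1 with h | h
    · have e : g (k + 1) s = g (k + 1) t := by
        simp only [g]
        rw [h]
      rw [e, dist_self]
      positivity
    · have e : ix (k + 1) t = ix (k + 1) s + 1 := by omega
      have hlt : ix (k + 1) s < N (k + 1) := lt_of_lt_of_le h (hixle (k + 1) t)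
      have e2 : g (k + 1) t = (c (k + 1) (ix (k + 1) s)).y := by
        rw [hcons (k + 1) (ix (k + 1) s) hlt, ← e]
      rw [e2]
      exact (hdiam k _ _ (c (k + 1) (ix (k + 1) s)).hx _ (c (k + 1) (ix (k + 1) s)).hy).le
  have hfl : ∀ k (s t : unitInterval), dist s t < 1 / N (k + 1) →
      ix (k + 1) t ≤ ix (k + 1) s + 1 := by
    intro k s t hst
    have hNp : (0 : ℝ) < N (k + 1) := by exact_mod_cast hNpos (k + 1)
    rw [Subtype.dist_eq, Real.dist_eq, abs_sub_comm, lt_div_iff₀ hNp] at hst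
    have h1 : (t : ℝ) * N (k + 1) < s * N (k + 1) + 1 := by
      have := le_abs_self ((t : ℝ) - s)
      nlinarith
    simp only [ix]
    rw [← Nat.floor_add_one (mul_nonneg s.2.1 hNp.le)]
    exact Nat.floor_le_floor h1.le
  refine ⟨γ, ?_, ?_, ?_, ?_⟩
  · rw [Metric.continuous_iff]
    intro t ε hε
    obtain ⟨k, hk⟩ := exists_pow_lt_of_lt_one (show (0 : ℝ) < ε / 5 by positivity)
      (show (1 / 2 : ℝ) < 1 by norm_num)
    have hNp : (0 : ℝ) < N (k + 1) := by exact_mod_cast hNpos (k + 1)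
    refine ⟨1 / N (k + 1), by positivity, ?_⟩
    intro s hst
    have hg : dist (g (k + 1) s) (g (k + 1) t) ≤ (1 / 2 : ℝ) ^ k := by
      rcases le_total (ix (k + 1) s) (ix (k + 1) t) with h | h
      · exact hnb k s t h (hfl k s t hst)
      · rw [dist_comm]
        exact hnb k t s h (hfl k t s (by rwa [dist_comm]))
    have h1 := hclose s k
    have h2 := hclose t k
    have h3 := dist_triangle4 (γ s) (g (k + 1) s) (g (k + 1) t) (γ t)
    rw [dist_comm (γ s) (g (k + 1) s)] at h3
    linarith
  · refine tendsto_nhds_unique (hγ 0) ?_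
    have : ∀ k, g (k + 1) 0 = l.x := by
      intro k
      simp only [g, ix]
      simp [hstart]
    simp only [this]
    exact tendsto_const_nhds
  · refine tendsto_nhds_unique (hγ 1) ?_
    have : ∀ k, g (k + 1) 1 = l.y := by
      intro k
      simp only [g, ix]
      simp [hend]
    simp only [this]
    exact tendsto_const_nhds
  · rintro _ ⟨t, rfl⟩
    exact mem_closure_of_tendsto (hγ t)
      (Filter.Eventually.of_forall fun k => hW (k + 1) (ix (k + 1) t) (c (k + 1) (ix (k + 1) t)).hx)

/-! ### Part 7: dendrites are hereditarily unicoherent -/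

lemma exists_arc_near {T : Type} [MetricSpace T] [CompactSpace T] [LocallyConnectedSpace T]
    (A : Set T) (hA : IsConnected A) (p q : T) (hp : p ∈ A) (hq : q ∈ A) (hpq : p ≠ q)
    (δ : ℝ) (hδ : 0 < δ) : ∃ α : unitInterval → T, Continuous α ∧ Function.Injective α ∧
      α 0 = p ∧ α 1 = q ∧ range α ⊆ Metric.cthickening δ A := by
  have hAs : A ⊆ Metric.thickening δ A := Metric.self_subset_thickening hδ A
  have hsub : A ⊆ connectedComponentIn (Metric.thickening δ A) p :=
    hA.isPreconnected.subset_connectedComponentIn hp hAs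
  let l : Link T := ⟨p, q, connectedComponentIn (Metric.thickening δ A) p,
    Metric.isOpen_thickening.connectedComponentIn, isPreconnected_connectedComponentIn,
    hsub hp, hsub hq⟩
  obtain ⟨γ, hγ, h0, h1, hr⟩ := exists_path_in_closure l
  change γ 0 = p at h0
  change γ 1 = q at h1
  obtain ⟨α, hα, hαi, e0, e1, hr2⟩ := exists_arc γ hγ (by rw [h0, h1]; exact hpq)
  refine ⟨α, hα, hαi, e0.trans h0, e1.trans h1, hr2.trans (hr.trans ?_)⟩
  exact (closure_mono (connectedComponentIn_subset _ _)).trans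
    (Metric.closure_thickening_subset_cthickening δ A)

lemma dendrite_hu (T : Type) [MetricSpace T] (h : IsDendriteSpace T) :
    HereditarilyUnicoherent T := by
  obtain ⟨-, hc, -, -, hl, hS⟩ := h
  intro A B hA hAc hB hBc
  by_contra hcon
  obtain ⟨U, V, hU, hV, hUV, hcov, ⟨p, hp, hpU⟩, ⟨q, hq, hqV⟩⟩ :=
    split_of_not_preconnected hA.isClosed hB.isClosed hcon
  obtain ⟨δ, hδ, hthick⟩ := exists_thick hA.isClosed hB.isClosed hAc.nonempty hBc.nonempty
    (hU.union hV) hcov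
  have hpq : p ≠ q := by
    rintro rfl
    exact Set.disjoint_left.1 hUV hpU hqV
  obtain ⟨a, ha, hai, ha0, ha1, har⟩ := exists_arc_near A hAc p q hp.1 hq.1 hpq δ hδ
  obtain ⟨b, hb, hbi, hb0, hb1, hbr⟩ := exists_arc_near B hBc p q hp.2 hq.2 hpq δ hδ
  obtain ⟨S, hSS⟩ := circle_of_arcs a b ha hb hai hbi (ha0.trans hb0.symm) (ha1.trans hb1.symm)
    U V hU hV hUV ((inter_subset_inter har hbr).trans hthick) (by rwa [ha0]) (by rwa [ha1])
  exact hS S hSS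


/-- No tree-like continuum has a proper open meager composant. -/
theorem treeLike_no_proper_open_meagerComposant (X : Type) [MetricSpace X] [CompactSpace X] [ConnectedSpace X] [Nonempty X] [Nontrivial X]
    (hX : TreeLike X) (x : X) (hopen : IsOpen (MeagerComposant X x)) :
    MeagerComposant X x = Set.univ := by
  exact hu_main X (treeLike_hu X hX (fun T _ h => dendrite_hu T h)) x hopen
end

section
/- Let X be a hereditarily unicoherent continuum. Then every meager composant of X is closed if and only if every indecomposable subcontinuum of X is nowhere dense. -/
open Set Topology

/-- Subcontinua. -/
def Ctm {X : Type} [TopologicalSpace X] (C : Set X) : Prop := IsCompact C ∧ IsConnected C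

/-- Boundary bumping. -/
theorem bump {X : Type} [MetricSpace X] {K V : Set X} {x : X} (hK : Ctm K) (hV : IsOpen V)
    (hxK : x ∈ K) (hxV : x ∉ V) (hKV : (K ∩ V).Nonempty) :
    ∃ C, Ctm C ∧ C ⊆ K \ V ∧ x ∈ C ∧ (C ∩ closure V).Nonempty := by
  have hF : IsCompact (K \ V) := hK.1.diff hV
  have : CompactSpace (K \ V : Set X) := isCompact_iff_compactSpace.mp hF
  let x' : (K \ V : Set X) := ⟨x, hxK, hxV⟩
  refine ⟨Subtype.val '' connectedComponent x', ⟨?_, ?_⟩, ?_, ?_, ?_⟩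
  · exact isClosed_connectedComponent.isCompact.image continuous_subtype_val
  · exact isConnected_connectedComponent.image _ continuous_subtype_val.continuousOn
  · rintro _ ⟨z, _, rfl⟩
    exact z.2
  · exact ⟨x', mem_connectedComponent, rfl⟩
  · by_contra hne
    have hdis : ∀ z : (K \ V : Set X), z ∈ connectedComponent x' → (z : X) ∉ closure V := by
      intro z hz hzV
      exact hne ⟨z, ⟨z, hz, rfl⟩, hzV⟩
    have hnon : Nonempty { s : Set (K \ V : Set X) // IsClopen s ∧ x' ∈ s } :=
      ⟨⟨univ, isClopen_univ, mem_univ _⟩⟩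
    obtain ⟨⟨Z, hZ, hxZ⟩, hZs⟩ := exists_subset_nhds_of_compactSpace
      (V := fun s : { s : Set (K \ V : Set X) // IsClopen s ∧ x' ∈ s } => (s : Set (K \ V : Set X)))
      (U := {z : (K \ V : Set X) | (z : X) ∉ closure V})
      (by
        intro a b
        exact ⟨⟨a.1 ∩ b.1, a.2.1.inter b.2.1, a.2.2, b.2.2⟩, inter_subset_left, inter_subset_right⟩)
      (fun s => s.2.1.1)
      (by
        intro z hz
        rw [← connectedComponent_eq_iInter_isClopen] at hz
        have ho : IsOpen {z : (K \ V : Set X) | (z : X) ∉ closure V} :=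
          (isClosed_closure.preimage continuous_subtype_val).isOpen_compl
        exact ho.mem_nhds (hdis z hz))
    have h1 : IsClosed (Subtype.val '' Z) := (hZ.1.isCompact.image continuous_subtype_val).isClosed
    have h2 : IsClosed (Subtype.val '' Zᶜ) :=
      (hZ.compl.1.isCompact.image continuous_subtype_val).isClosed
    obtain ⟨w, hw, hwV⟩ := hKV
    obtain ⟨p, hp, ⟨z, hz, rfl⟩, hp2⟩ := isPreconnected_closed_iff.1 hK.2.2 (Subtype.val '' Z)
      (Subtype.val '' Zᶜ ∪ closure V) h1 (h2.union isClosed_closure)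
      (by
        intro p hp
        by_cases hpV : p ∈ V
        · exact Or.inr (Or.inr (subset_closure hpV))
        · by_cases hpZ : (⟨p, hp, hpV⟩ : (K \ V : Set X)) ∈ Z
          · exact Or.inl ⟨_, hpZ, rfl⟩
          · exact Or.inr (Or.inl ⟨_, hpZ, rfl⟩))
      ⟨x, hxK, x', hxZ, rfl⟩ ⟨w, hw, Or.inr (subset_closure hwV)⟩
    rcases hp2 with ⟨z', hz', he⟩ | hp2
    · exact hz' (by rwa [Subtype.ext he])
    · exact hZs hz hp2

theorem sep_aux {X : Type} [MetricSpace X] {K C O₁ O₂ : Set X} (hK : Ctm K) (hC : Ctm C)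
    (hCK : C ⊆ K) (h1 : IsOpen O₁) (h2 : IsOpen O₂) (hcov : K \ C ⊆ O₁ ∪ O₂)
    (hdis : ∀ z ∈ K \ C, z ∈ O₁ → z ∉ O₂) : Ctm (C ∪ K \ O₂) := by
  have hc : IsCompact (C ∪ K \ O₂) := hC.1.union (hK.1.diff h2)
  refine ⟨hc, hC.2.1.mono subset_union_left, ?_⟩
  have key : ∀ u v : Set X, IsClosed u → IsClosed v → C ∪ K \ O₂ ⊆ u ∪ v → Disjoint u v →
      C ⊆ u → C ∪ K \ O₂ ⊆ u := by
    intro u v hu hv hs huv hCu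
    by_contra hnot
    obtain ⟨p, hp, hpu⟩ := not_subset.1 hnot
    have hpv : p ∈ v := (hs hp).resolve_left hpu
    obtain ⟨c, hcC⟩ := hC.2.1
    obtain ⟨q, hqK, ⟨hq1, hq2⟩, hq3⟩ := isPreconnected_closed_iff.1 hK.2.2
      ((C ∪ K \ O₂) ∩ v) (u ∪ K \ O₁) (hc.isClosed.inter hv)
      (hu.union (hK.1.diff h1).isClosed)
      (by
        intro z hz
        by_cases hz1 : z ∈ O₁
        · by_cases hzC : z ∈ C
          · exact Or.inr (Or.inl (hCu hzC))
          · have : z ∈ C ∪ K \ O₂ := Or.inr ⟨hz, hdis z ⟨hz, hzC⟩ hz1⟩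
            rcases hs this with h | h
            · exact Or.inr (Or.inl h)
            · exact Or.inl ⟨this, h⟩
        · exact Or.inr (Or.inr ⟨hz, hz1⟩))
      ⟨p, by rcases hp with h | h; exacts [hCK h, h.1], hp, hpv⟩
      ⟨c, hCK hcC, Or.inl (hCu hcC)⟩
    have hqu : q ∉ u := fun h => huv.le_bot ⟨h, hq2⟩
    rcases hq3 with h | h
    · exact hqu h
    · rcases hq1 with h' | h'
      · exact hqu (hCu h')
      · rcases hcov ⟨hqK, fun hh => hqu (hCu hh)⟩ with h3 | h3
        · exact h.2 h3
        · exact h'.2 h3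
  rw [isPreconnected_iff_subset_of_fully_disjoint_closed hc.isClosed]
  intro u v hu hv hs huv
  rcases (isPreconnected_iff_subset_of_fully_disjoint_closed hC.1.isClosed).1 hC.2.2 u v hu hv
    (subset_union_left.trans hs) huv with h | h
  · exact Or.inl (key u v hu hv hs huv h)
  · exact Or.inr (key v u hv hu (by rwa [union_comm v u]) huv.symm h)

theorem sep {X : Type} [MetricSpace X] {K C : Set X} (hK : Ctm K) (hC : Ctm C) (hCK : C ⊆ K) :
    IsPreconnected (K \ C) ∨ ∃ H₁ H₂, Ctm H₁ ∧ Ctm H₂ ∧ C ⊆ H₁ ∧ C ⊆ H₂ ∧ H₁ ⊆ K ∧ H₂ ⊆ K ∧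
      H₁ ≠ K ∧ H₂ ≠ K ∧ H₁ ∪ H₂ = K := by
  by_cases hp : IsPreconnected (K \ C)
  · exact Or.inl hp
  right
  unfold IsPreconnected at hp
  push Not at hp
  obtain ⟨O₁, O₂, h1, h2, hcov, ⟨a, haK, ha⟩, ⟨b, hbK, hb⟩, hem⟩ := hp
  have hd : ∀ z ∈ K \ C, z ∈ O₁ → z ∉ O₂ := by
    intro z hz hz1 hz2
    have : z ∈ K \ C ∩ (O₁ ∩ O₂) := ⟨hz, hz1, hz2⟩
    rw [hem] at this
    exact this
  refine ⟨C ∪ K \ O₂, C ∪ K \ O₁, sep_aux hK hC hCK h1 h2 hcov hd,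
    sep_aux hK hC hCK h2 h1 (by rwa [union_comm]) (fun z hz hz2 hz1 => hd z hz hz1 hz2),
    subset_union_left, subset_union_left, union_subset hCK sdiff_subset,
    union_subset hCK sdiff_subset, ?_, ?_, ?_⟩
  · intro h
    have : b ∈ C ∪ K \ O₂ := by rw [h]; exact hbK.1
    rcases this with h | h
    · exact hbK.2 h
    · exact h.2 hb
  · intro h
    have : a ∈ C ∪ K \ O₁ := by rw [h]; exact haK.1
    rcases this with h | h
    · exact haK.2 h
    · exact h.2 ha
  · apply Subset.antisymm
    · exact union_subset (union_subset hCK sdiff_subset) (union_subset hCK sdiff_subset)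
    · intro z hz
      by_cases hzC : z ∈ C
      · exact Or.inl (Or.inl hzC)
      · by_cases hz1 : z ∈ O₁
        · exact Or.inl (Or.inr ⟨hz, hd z ⟨hz, hzC⟩ hz1⟩)
        · exact Or.inr (Or.inr ⟨hz, hz1⟩)

theorem hull {X : Type} [MetricSpace X] [CompactSpace X] [ConnectedSpace X]
    (hX : HereditarilyUnicoherent X) (T : Set X) (hT : T.Nonempty) :
    ∃ I, Ctm I ∧ T ⊆ I ∧ ∀ C, Ctm C → T ⊆ C → I ⊆ C := by
  let ι := {C : Set X // Ctm C ∧ T ⊆ C}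
  have : Nonempty ι := ⟨⟨univ, ⟨isCompact_univ, isConnected_univ⟩, subset_univ _⟩⟩
  have hcl : IsClosed (⋂ i : ι, i.1) := isClosed_iInter fun i => i.2.1.1.isClosed
  have hTI : T ⊆ ⋂ i : ι, i.1 := subset_iInter fun i => i.2.2
  refine ⟨⋂ i : ι, i.1, ⟨hcl.isCompact, hT.mono hTI, ?_⟩, hTI, fun C h1 h2 =>
    iInter_subset (fun i : ι => i.1) ⟨C, h1, h2⟩⟩
  rw [isPreconnected_iff_subset_of_fully_disjoint_closed hcl]
  intro a b ha hb hab habd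
  obtain ⟨u, v, hu, hv, hau, hbv, huv⟩ := normal_separation ha hb habd
  obtain ⟨i, hi⟩ := exists_subset_nhds_of_compactSpace (V := fun i : ι => i.1) (U := u ∪ v)
    (by
      intro A B
      exact ⟨⟨A.1 ∩ B.1, ⟨A.2.1.1.inter B.2.1.1, hT.mono (subset_inter A.2.2 B.2.2),
        hX _ _ A.2.1.1 A.2.1.2 B.2.1.1 B.2.1.2⟩, subset_inter A.2.2 B.2.2⟩,
        inter_subset_left, inter_subset_right⟩)
    (fun i => i.2.1.1.isClosed)
    (fun z hz => (hu.union hv).mem_nhds (union_subset_union hau hbv (hab hz)))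
  have hIi : (⋂ i : ι, i.1) ⊆ i.1 := iInter_subset _ i
  rcases i.2.1.2.2.subset_or_subset hu hv huv hi with h | h
  · left
    intro z hz
    exact (hab hz).resolve_right fun hzb => huv.le_bot ⟨h (hIi hz), hbv hzb⟩
  · right
    intro z hz
    exact (hab hz).resolve_left fun hza => huv.le_bot ⟨hau hza, h (hIi hz)⟩

theorem Ctm.nwd {X : Type} [MetricSpace X] {C : Set X} (h : Ctm C) :
    IsNowhereDense C ↔ interior C = ∅ := h.1.isClosed.isNowhereDense_iff

theorem self_mem_mc {X : Type} [MetricSpace X] [ConnectedSpace X] [Nontrivial X] (x : X) :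
    x ∈ MeagerComposant X x :=
  ⟨{x}, ⟨isCompact_singleton, isConnected_singleton,
    (isClosed_singleton).isNowhereDense_iff.2 (interior_singleton x), rfl⟩, rfl⟩

theorem indec_interior {X : Type} [MetricSpace X] {K C : Set X} (hK : Ctm K)
    (hi : IndecomposableSet K) (hC : Ctm C) (hCK : C ⊆ K) (hne : C ≠ K) : interior C = ∅ := by
  by_contra hint
  obtain ⟨p, hp⟩ := nonempty_iff_ne_empty.2 hint
  rcases sep hK hC hCK with h | ⟨H₁, H₂, a1, a2, _, _, a3, a4, a5, a6, a7⟩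
  · have hsub : closure (K \ C) ⊆ K := closure_minimal sdiff_subset hK.1.isClosed
    refine hi ⟨C, closure (K \ C), hC.1, hC.2, hK.1.of_isClosed_subset isClosed_closure hsub,
      ⟨?_, h.closure⟩, hCK, hsub, hne, ?_, ?_⟩
    · exact (sdiff_nonempty.2 fun h => hne (hCK.antisymm h)).closure
    · intro he
      have hpc : p ∈ closure (K \ C) := by rw [he]; exact hCK (interior_subset hp)
      obtain ⟨q, hq1, hq2⟩ := mem_closure_iff.1 hpc _ isOpen_interior hp
      exact hq2.2 (interior_subset hq1)
    · apply (union_subset hCK hsub).antisymm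
      intro z hz
      by_cases hzC : z ∈ C
      · exact Or.inl hzC
      · exact Or.inr (subset_closure ⟨hz, hzC⟩)
  · exact hi ⟨H₁, H₂, a1.1, a1.2, a2.1, a2.2, a3, a4, a5, a6, a7⟩

theorem forward {X : Type} [MetricSpace X] [CompactSpace X] [ConnectedSpace X] [Nontrivial X]
    (hX : HereditarilyUnicoherent X) (hcl : ∀ x : X, IsClosed (MeagerComposant X x))
    (K : Set X) (hK : Ctm K) (hi : IndecomposableSet K) : IsNowhereDense K := by
  rw [hK.nwd]
  by_contra hint
  have hne := nonempty_iff_ne_empty.2 hint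
  obtain ⟨x, hx⟩ := hK.2.1
  have hKM : K ⊆ MeagerComposant X x := by
    intro z hz
    rw [← (hcl x).closure_eq, mem_closure_iff_nhds]
    intro V hV
    obtain ⟨W, hW, hWc, hWV⟩ := mem_nhds_iff.1 hV |> fun ⟨O, hO, ho, hz⟩ =>
      (⟨O, ho, hz, hO⟩ : ∃ O, IsOpen O ∧ z ∈ O ∧ O ⊆ V)
    obtain ⟨V', hV', hzV', hcV'⟩ : ∃ V', IsOpen V' ∧ z ∈ V' ∧ closure V' ⊆ W := by
      obtain ⟨V', a, b, c, d⟩ := exists_open_between_and_isCompact_closure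
        (isCompact_singleton (x := z)) hW (by simpa using hWc)
      exact ⟨V', a, by simpa using b, c⟩
    by_cases hxV : x ∈ V'
    · exact ⟨x, hWV (hcV' (subset_closure hxV)), self_mem_mc x⟩
    · obtain ⟨C, hC, hCs, hxC, c, hc, hcV⟩ := bump hK hV' hx hxV ⟨z, hz, hzV'⟩
      refine ⟨c, hWV (hcV' hcV), C, ⟨hC.1, hC.2, hC.nwd.2 ?_, hxC⟩, hc⟩
      refine indec_interior hK hi hC (fun p hp => (hCs hp).1) ?_
      rintro rfl
      exact (hCs hz).2 hzV'
  let B : Set (Set X) := {b ∈ TopologicalSpace.countableBasis X | (K ∩ b).Nonempty}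
  have hB : B.Countable := (TopologicalSpace.countable_countableBasis X).mono (sep_subset _ _)
  let f : Set X → Set X := fun b => closure (connectedComponentIn (K \ b) x)
  have hmeag : IsMeagre (⋃ b ∈ B, f b) := by
    refine isMeagre_biUnion hB fun b hb => IsNowhereDense.isMeagre ?_
    have hbo : IsOpen b := TopologicalSpace.isOpen_of_mem_countableBasis hb.1
    have hfs : f b ⊆ K \ b :=
      closure_minimal (connectedComponentIn_subset _ _) (hK.1.diff hbo).isClosed
    by_cases hxb : x ∈ K \ b
    · have hf : Ctm (f b) := ⟨isClosed_closure.isCompact,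
        (isConnected_connectedComponentIn_iff.2 hxb).closure⟩
      rw [hf.nwd]
      refine indec_interior hK hi hf (fun p hp => (hfs hp).1) ?_
      intro he
      obtain ⟨w, hw, hwb⟩ := hb.2
      exact (hfs (he ▸ hw)).2 hwb
    · simp only [f, connectedComponentIn_eq_empty hxb, closure_empty]
      exact isNowhereDense_empty
  refine not_isMeagre_of_isOpen isOpen_interior hne (hmeag.mono ?_)
  intro z hz
  have hzK := interior_subset hz
  obtain ⟨L, ⟨hL1, hL2, hL3, hxL⟩, hzL⟩ := hKM hzK
  have hnot : ¬ K ⊆ L := by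
    intro h
    rw [hL1.isClosed.isNowhereDense_iff] at hL3
    exact hint (subset_empty_iff.1 (hL3 ▸ interior_mono h))
  obtain ⟨w, hwK, hwL⟩ := not_subset.1 hnot
  obtain ⟨b, hb, hwb, hbL⟩ := (TopologicalSpace.isBasis_countableBasis X).exists_subset_of_mem_open
    (show w ∈ Lᶜ from hwL) hL1.isClosed.isOpen_compl
  refine mem_biUnion (show b ∈ B from ⟨hb, w, hwK, hwb⟩) (subset_closure ?_)
  exact (hX L K hL1 hL2 hK.1 hK.2).subset_connectedComponentIn ⟨hxL, hx⟩
    (fun p hp => ⟨hp.2, fun h => hbL h hp.1⟩ : L ∩ K ⊆ K \ b) ⟨hzL, hzK⟩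

theorem backward {X : Type} [MetricSpace X] [CompactSpace X] [ConnectedSpace X] [Nontrivial X]
    (hX : HereditarilyUnicoherent X)
    (hind : ∀ K : Set X, IsCompact K → IsConnected K → IndecomposableSet K → IsNowhereDense K)
    (x : X) : IsClosed (MeagerComposant X x) := by
  rw [← closure_subset_iff_isClosed]
  intro y hy
  by_contra hyM
  obtain ⟨I, hI, hTI, hmin⟩ := hull hX {x, y} ⟨x, by simp⟩
  have hxI : x ∈ I := hTI (by simp)
  have hyI : y ∈ I := hTI (by simp)
  have hmin' : ∀ C, Ctm C → x ∈ C → y ∈ C → I ⊆ C := fun C hC h1 h2 =>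
    hmin C hC (by rintro z (rfl | rfl) <;> assumption)
  have hUne : (interior I).Nonempty := by
    by_contra h
    exact hyM ⟨I, ⟨hI.1, hI.2, hI.nwd.2 (not_nonempty_iff_eq_empty.1 h), hxI⟩, hyI⟩
  obtain ⟨U, hU⟩ : ∃ U, U = interior I := ⟨_, rfl⟩
  rw [← hU] at hUne
  have hUo : IsOpen U := hU ▸ isOpen_interior
  have hUI : U ⊆ I := hU ▸ interior_subset
  -- step a
  have ha : ∀ z ∈ MeagerComposant X x, ∀ B, Ctm B → z ∈ B → y ∈ B → U ⊆ B := by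
    rintro z ⟨L, ⟨hL1, hL2, hL3, hxL⟩, hzL⟩ B hB hzB hyB
    have hIs : I ⊆ L ∪ B := hmin' _ ⟨hL1.union hB.1, hL2.union ⟨z, hzL, hzB⟩ hB.2⟩
      (Or.inl hxL) (Or.inr hyB)
    rw [hL1.isClosed.isNowhereDense_iff] at hL3
    intro u hu
    by_contra huB
    have : u ∈ interior L := interior_maximal (t := U \ B)
      (fun p hp => (hIs (hUI hp.1)).resolve_right hp.2) (hUo.sdiff hB.1.isClosed) ⟨hu, huB⟩
    rw [hL3] at this
    exact this
  have hcM : I ⊆ closure (MeagerComposant X x) := by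
    refine hmin' _ ⟨isClosed_closure.isCompact, IsConnected.closure ⟨⟨x, self_mem_mc x⟩, ?_⟩⟩
      (subset_closure (self_mem_mc x)) hy
    exact isPreconnected_sUnion x _ (fun s hs => hs.2.2.2) (fun s hs => hs.2.1.2)
  -- step b
  have hb : ∀ B, Ctm B → y ∈ B → ¬ U ⊆ B → ∀ p ∈ U, p ∉ interior B := by
    intro B hB hyB hUB p hpU hpB
    obtain ⟨q, ⟨hq1, hq2⟩, hq3⟩ := mem_closure_iff.1 (hcM (hUI hpU)) (U ∩ interior B)
      (hUo.inter isOpen_interior) ⟨hpU, hpB⟩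
    exact hUB (ha q hq3 B hB (interior_subset hq2) hyB)
  -- step c
  have hc : ∀ A, Ctm A → A ⊆ I → x ∈ A → ∀ p ∈ U, p ∈ interior A → U ⊆ A := by
    intro A hA hAI hxA p hpU hpA
    rcases sep hI hA hAI with h | ⟨H₁, H₂, a1, a2, b1, b2, a3, a4, a5, a6, a7⟩
    · by_cases hyA : y ∈ A
      · exact hUI.trans (hmin' A hA hxA hyA)
      · have hyB : y ∈ closure (I \ A) := subset_closure ⟨hyI, hyA⟩
        have hB : Ctm (closure (I \ A)) := ⟨isClosed_closure.isCompact,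
          IsConnected.closure ⟨⟨y, hyI, hyA⟩, h⟩⟩
        have hUB : ¬ U ⊆ closure (I \ A) := by
          intro hs
          obtain ⟨q, hq1, hq2⟩ := mem_closure_iff.1 (hs hpU) _ isOpen_interior hpA
          exact hq2.2 (interior_subset hq1)
        intro u hu
        by_contra huA
        refine hb _ hB hyB hUB u hu (interior_maximal (t := U \ A)
          (fun q hq => subset_closure (s := I \ A) ⟨hUI hq.1, hq.2⟩) (hUo.sdiff hA.1.isClosed) ⟨hu, huA⟩)
    · exfalso
      rw [← a7] at hyI
      rcases hyI with h | h
      · exact a5 (a3.antisymm (hmin' _ a1 (b1 hxA) h))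
      · exact a6 (a4.antisymm (hmin' _ a2 (b2 hxA) h))
  -- step d
  obtain ⟨J, hJ, hUJ, hJmin⟩ := hull hX U hUne
  have hJI : J ⊆ I := hJmin I hI hUI
  have hJdec : ¬ IndecomposableSet J := by
    intro h
    have h1 := hJ.nwd.1 (hind J hJ.1 hJ.2 h)
    obtain ⟨u, hu⟩ := hUne
    have : u ∈ interior J := interior_maximal hUJ hUo hu
    rw [h1] at this
    exact this
  unfold IndecomposableSet at hJdec
  rw [not_not] at hJdec
  obtain ⟨H, K, hH1, hH2, hK1, hK2, hHJ, hKJ, hHne, hKne, hHK⟩ := hJdec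
  obtain ⟨u, huU, hux⟩ : ∃ u ∈ U, u ≠ x := by
    by_contra hall
    push Not at hall
    obtain ⟨u, hu⟩ := hUne
    have : u ∈ interior ({x} : Set X) := interior_maximal (fun p hp => hall p hp) hUo hu
    rw [interior_singleton] at this
    exact this
  obtain ⟨V, hV, huV, hcV, -⟩ := exists_open_between_and_isCompact_closure
    (isCompact_singleton (x := u)) (hUo.sdiff (isClosed_singleton (x := x)))
    (by simpa using ⟨huU, hux⟩)
  have huV' : u ∈ V := by simpa using huV
  obtain ⟨C, hC, hCs, hxC, h, hhC, hhV⟩ := bump hI hV hxI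
    (fun hxV => (hcV (subset_closure hxV)).2 rfl) ⟨u, hUI huU, huV'⟩
  have hCI : C ⊆ I := fun p hp => (hCs hp).1
  have final : ∀ H K : Set X, Ctm H → Ctm K → H ⊆ J → K ⊆ J → H ≠ J → K ≠ J → H ∪ K = J →
      h ∈ H → False := by
    intro H K hH hK hHJ hKJ hHne hKne hHK hhH
    have hUK : ¬ U ⊆ K := fun hs => hKne (hKJ.antisymm (hJmin K hK hs))
    have hUH : ¬ U ⊆ H := fun hs => hHne (hHJ.antisymm (hJmin H hH hs))
    obtain ⟨p, hpU, hpK⟩ := not_subset.1 hUK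
    obtain ⟨q, hqU, hqH⟩ := not_subset.1 hUH
    have hpH : p ∈ interior H := interior_maximal (t := U \ K)
      (fun z hz => by
        have hzJ := hUJ hz.1
        rw [← hHK] at hzJ
        exact hzJ.resolve_right hz.2) (hUo.sdiff hK.1.isClosed) ⟨hpU, hpK⟩
    have h1 : U ⊆ C ∪ H := hc (C ∪ H) ⟨hC.1.union hH.1, hC.2.union ⟨h, hhC, hhH⟩ hH.2⟩
      (union_subset hCI (hHJ.trans hJI)) (Or.inl hxC) p hpU (interior_mono subset_union_right hpH)
    have hqC : q ∈ interior C := interior_maximal (t := U \ H)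
      (fun z hz => (h1 hz.1).resolve_right hz.2) (hUo.sdiff hH.1.isClosed) ⟨hqU, hqH⟩
    have h2 := hc C hC hCI hxC q hqU hqC
    exact (hCs (h2 huU)).2 huV'
  have hhJ : h ∈ H ∪ K := hHK ▸ hUJ (hcV hhV).1
  rcases hhJ with hh | hh
  · exact final H K ⟨hH1, hH2⟩ ⟨hK1, hK2⟩ hHJ hKJ hHne hKne hHK hh
  · exact final K H ⟨hK1, hK2⟩ ⟨hH1, hH2⟩ hKJ hHJ hKne hHne (by rwa [union_comm]) hh

/-- Characterization: in a (nondegenerate) hereditarily unicoherent continuum, every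
meager composant is closed iff every indecomposable subcontinuum is nowhere dense. -/
theorem meagerComposants_closed_iff_indecomposables_nowhereDense (X : Type) [MetricSpace X] [CompactSpace X] [ConnectedSpace X] [Nonempty X] [Nontrivial X]
    (hX : HereditarilyUnicoherent X) :
    (∀ x : X, IsClosed (MeagerComposant X x)) ↔
      (∀ K : Set X, IsCompact K → IsConnected K → IndecomposableSet K →
        IsNowhereDense K) := by
  exact ⟨fun h K h1 h2 h3 => forward hX h K ⟨h1, h2⟩ h3, fun h x => backward hX h x⟩
end

section
/- Let X be a hereditarily unicoherent continuum in which every meager composant is closed. Then the equivalence relation E = {(x,y) ∈ X × X : y ∈ M_x} is a closed subset of X × X. -/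
open Set Topology

section Helpers

variable {X : Type} [MetricSpace X] [CompactSpace X]

theorem exists_irreducible (x y : X) [ConnectedSpace X] (hX : HereditarilyUnicoherent X) :
    ∃ K : Set X, IsCompact K ∧ IsConnected K ∧ x ∈ K ∧ y ∈ K ∧
      ∀ D : Set X, IsCompact D → IsConnected D → x ∈ D → y ∈ D → K ⊆ D := by
  let S := {D : Set X // IsCompact D ∧ IsConnected D ∧ x ∈ D ∧ y ∈ D}
  haveI : Nonempty S := ⟨⟨univ, isCompact_univ, isConnected_univ, mem_univ _, mem_univ _⟩⟩
  let K : Set X := ⋂ D : S, D.1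
  have hKc : IsClosed K := isClosed_iInter fun D => D.2.1.isClosed
  have hxK : x ∈ K := mem_iInter.2 fun D => D.2.2.2.1
  have hyK : y ∈ K := mem_iInter.2 fun D => D.2.2.2.2
  have hdir : Directed (· ⊇ ·) (fun D : S => D.1) := by
    rintro ⟨A, hA, hA', hxA, hyA⟩ ⟨B, hB, hB', hxB, hyB⟩
    exact ⟨⟨A ∩ B, hA.inter hB, ⟨⟨x, hxA, hxB⟩, hX A B hA hA' hB hB'⟩, ⟨hxA, hxB⟩, ⟨hyA, hyB⟩⟩,
      inter_subset_left, inter_subset_right⟩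
  refine ⟨K, hKc.isCompact, ⟨⟨x, hxK⟩, ?_⟩, hxK, hyK,
    fun D h1 h2 h3 h4 => iInter_subset (fun D : S => D.1) ⟨D, h1, h2, h3, h4⟩⟩
  rw [isPreconnected_iff_subset_of_fully_disjoint_closed hKc]
  intro F G hF hG hFG hd
  obtain ⟨U, V, hU, hV, hFU, hGV, hUV⟩ := normal_separation hF hG hd
  obtain ⟨D, hD⟩ := exists_subset_nhds_of_isCompact' (V := fun D : S => D.1) hdir
    (fun D => D.2.1) (fun D => D.2.1.isClosed) (U := U ∪ V)
    (fun z hz => (hU.union hV).mem_nhds (union_subset_union hFU hGV (hFG hz)))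
  have hKD : K ⊆ D.1 := iInter_subset (fun D : S => D.1) D
  have := isPreconnected_iff_subset_of_disjoint.1 D.2.2.1.isPreconnected U V hU hV hD
    (by rw [hUV.inter_eq, inter_empty])
  rcases this with h | h
  · left
    intro z hz
    exact (hFG hz).resolve_right fun hzG => hUV.ne_of_mem (h (hKD hz)) (hGV hzG) rfl
  · right
    intro z hz
    exact (hFG hz).resolve_left fun hzF => hUV.ne_of_mem (hFU hzF) (h (hKD hz)) rfl

theorem compl_preconnected {x y : X} {K N : Set X} (hK : IsCompact K) (hKc : IsConnected K)
    (hirr : ∀ D : Set X, IsCompact D → IsConnected D → x ∈ D → y ∈ D → K ⊆ D)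
    (hyK : y ∈ K) (hN : IsCompact N) (hNc : IsConnected N) (hNK : N ⊆ K)
    (hxN : x ∈ N) (hyN : y ∉ N) : IsPreconnected (K \ N) := by
  have key : ∀ U V : Set X, IsOpen U → IsOpen V → K \ N ⊆ U ∪ V → (K \ N) ∩ (U ∩ V) = ∅ →
      y ∈ U → K \ N ⊆ U := by
    intro U V hU hV hUV hd hyU
    have hd' : ∀ z ∈ K, z ∉ N → z ∈ U → z ∈ V → False := fun z h1 h2 h3 h4 => by
      have : z ∈ (K \ N) ∩ (U ∩ V) := ⟨⟨h1, h2⟩, h3, h4⟩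
      rw [hd] at this; exact this
    have hD : IsClosed (K ∩ (V ∩ Nᶜ)ᶜ) :=
      hK.isClosed.inter (hV.inter hN.isClosed.isOpen_compl).isClosed_compl
    have hE : IsClosed (K ∩ (U ∩ Nᶜ)ᶜ) :=
      hK.isClosed.inter (hU.inter hN.isClosed.isOpen_compl).isClosed_compl
    have hND : N ⊆ K ∩ (V ∩ Nᶜ)ᶜ := fun z hz => ⟨hNK hz, fun h => h.2 hz⟩
    have aux : ∀ F G : Set X, IsClosed F → IsClosed G → K ∩ (V ∩ Nᶜ)ᶜ ⊆ F ∪ G → Disjoint F G →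
        N ⊆ F → K ∩ (V ∩ Nᶜ)ᶜ ⊆ F := by
      intro F G hF hG hFG hdis hNF
      have h2 := (isPreconnected_iff_subset_of_fully_disjoint_closed hK.isClosed).1
        hKc.isPreconnected (G ∩ (K ∩ (V ∩ Nᶜ)ᶜ)) ((F ∩ (K ∩ (V ∩ Nᶜ)ᶜ)) ∪ (K ∩ (U ∩ Nᶜ)ᶜ))
        (hG.inter hD) ((hF.inter hD).union hE) ?_ ?_
      · rcases h2 with h2 | h2
        · exact absurd rfl (hdis.ne_of_mem (hNF hxN) (h2 (hNK hxN)).1)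
        · intro z hz
          refine (hFG hz).resolve_right fun hzG => ?_
          have hzN : z ∉ N := fun h => hdis.ne_of_mem (hNF h) hzG rfl
          rcases h2 hz.1 with h | h
          · exact hdis.ne_of_mem h.1 hzG rfl
          · have hzU : z ∉ U := fun hu => h.2 ⟨hu, hzN⟩
            have hzV : z ∉ V := fun hv => hz.2 ⟨hv, hzN⟩
            exact (hUV ⟨hz.1, hzN⟩).elim hzU hzV
      · intro z hz
        by_cases h : z ∈ U ∩ Nᶜ
        · have hzD : z ∈ K ∩ (V ∩ Nᶜ)ᶜ := ⟨hz, fun h' => hd' z hz h.2 h.1 h'.1⟩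
          rcases hFG hzD with h' | h'
          · exact Or.inr (Or.inl ⟨h', hzD⟩)
          · exact Or.inl ⟨h', hzD⟩
        · exact Or.inr (Or.inr ⟨hz, h⟩)
      · rw [Set.disjoint_left]
        rintro z ⟨hzG, hzD⟩ (h | h)
        · exact hdis.ne_of_mem h.1 hzG rfl
        · have hzN : z ∉ N := fun h => hdis.ne_of_mem (hNF h) hzG rfl
          have hzU : z ∉ U := fun hu => h.2 ⟨hu, hzN⟩
          have hzV : z ∉ V := fun hv => hzD.2 ⟨hv, hzN⟩
          exact (hUV ⟨hzD.1, hzN⟩).elim hzU hzV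
    have hDc : IsPreconnected (K ∩ (V ∩ Nᶜ)ᶜ) := by
      rw [isPreconnected_iff_subset_of_fully_disjoint_closed hD]
      intro F G hF hG hFG hdis
      rcases (isPreconnected_iff_subset_of_fully_disjoint_closed hN.isClosed).1
        hNc.isPreconnected F G hF hG (hND.trans hFG) hdis with h | h
      · exact Or.inl (aux F G hF hG hFG hdis h)
      · exact Or.inr (aux G F hG hF (by rwa [union_comm]) hdis.symm h)
    have := hirr _ hD.isCompact ⟨⟨x, hND hxN⟩, hDc⟩ (hND hxN)
      ⟨hyK, fun h => hd' y hyK hyN hyU h.1⟩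
    intro z hz
    exact (hUV hz).resolve_right fun hv => (this hz.1).2 ⟨hv, hz.2⟩
  rw [isPreconnected_iff_subset_of_disjoint]
  intro U V hU hV hUV hd
  rcases hUV ⟨hyK, hyN⟩ with h | h
  · exact Or.inl (key U V hU hV hUV hd h)
  · exact Or.inr (key V U hV hU (by rwa [union_comm]) (by rwa [inter_comm V U]) h)

theorem interior_empty_aux (hX : HereditarilyUnicoherent X) {x y : X} {K N : Set X}
    (hK : IsCompact K) (hKc : IsConnected K)
    (hirr : ∀ D : Set X, IsCompact D → IsConnected D → x ∈ D → y ∈ D → K ⊆ D)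
    (hxK : x ∈ K) (hyK : y ∈ K) (hN : IsCompact N) (hNc : IsConnected N) (hNK : N ⊆ K)
    (hxN : x ∈ N) (hyN : y ∉ N)
    (hL : ∀ z ∈ N, ∃ L : Set X, IsCompact L ∧ IsConnected L ∧ IsNowhereDense L ∧ x ∈ L ∧ z ∈ L) :
    interior N = ∅ := by
  have hpre := compl_preconnected hK hKc hirr hyK hN hNc hNK hxN hyN
  have hyB : y ∈ closure (K \ N) := subset_closure ⟨hyK, hyN⟩
  have hBc : IsConnected (closure (K \ N)) := ⟨⟨y, hyB⟩, hpre.closure⟩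
  have hBK : closure (K \ N) ⊆ K := closure_minimal diff_subset hK.isClosed
  have hdis : ∀ z ∈ interior N, z ∉ closure (K \ N) := by
    intro z hz hzB
    obtain ⟨w, hw, hw'⟩ := mem_closure_iff.1 hzB _ isOpen_interior hz
    exact hw'.2 (interior_subset hw)
  by_contra hne
  obtain ⟨w, hw⟩ := nonempty_iff_ne_empty.2 hne
  have hxB : x ∉ closure (K \ N) := fun h =>
    hdis w hw (hirr _ isClosed_closure.isCompact hBc h hyB (hNK (interior_subset hw)))
  have hAN : closure (K \ closure (K \ N)) ⊆ N := by
    refine closure_minimal ?_ hN.isClosed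
    intro z hz
    by_contra hzN
    exact hz.2 (subset_closure ⟨hz.1, hzN⟩)
  obtain ⟨t, htK, htA, htB⟩ := isPreconnected_closed_iff.1 hKc.isPreconnected
    (closure (K \ closure (K \ N))) (closure (K \ N)) isClosed_closure isClosed_closure
    (fun z hz => by
      by_cases h : z ∈ closure (K \ N)
      · exact Or.inr h
      · exact Or.inl (subset_closure ⟨hz, h⟩))
    ⟨x, hxK, subset_closure ⟨hxK, hxB⟩⟩ ⟨y, hyK, hyB⟩
  obtain ⟨L, hLc, hLconn, hLn, hxL, htL⟩ := hL t (hAN htA)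
  have hconn : IsConnected ((L ∩ K) ∪ closure (K \ N)) :=
    IsConnected.union ⟨t, ⟨htL, htK⟩, htB⟩
      ⟨⟨x, hxL, hxK⟩, hX L K hLc hLconn hK hKc⟩ hBc
  have hsub := hirr _ ((hLc.inter hK).union isClosed_closure.isCompact) hconn
    (Or.inl ⟨hxL, hxK⟩) (Or.inr hyB)
  have hNL : interior N ⊆ L := fun z hz =>
    ((hsub (hNK (interior_subset hz))).resolve_right (hdis z hz)).1
  have := interior_maximal hNL isOpen_interior hw
  rw [hLc.isClosed.isNowhereDense_iff.1 hLn] at this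
  exact this

theorem boundary_bump {x : X} {K N U : Set X} (hK : IsCompact K) (hKc : IsConnected K)
    (hxK : x ∈ K) (hxN : x ∈ N) (hU : IsOpen U) (hUN : Disjoint (closure U) N)
    (hUK : (U ∩ K).Nonempty) :
    ∃ A : Set X, IsCompact A ∧ IsConnected A ∧ x ∈ A ∧ A ⊆ K \ U ∧ ¬ A ⊆ N := by
  have hF : IsClosed (K \ U) := hK.isClosed.sdiff hU
  haveI : CompactSpace (K \ U : Set X) := isCompact_iff_compactSpace.1 hF.isCompact
  have hxF : x ∈ K \ U := ⟨hxK, fun h => hUN.ne_of_mem (subset_closure h) hxN rfl⟩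
  let x' : (K \ U : Set X) := ⟨x, hxF⟩
  refine ⟨Subtype.val '' connectedComponent x', ?_, ?_, ⟨x', mem_connectedComponent, rfl⟩, ?_, ?_⟩
  · exact isClosed_connectedComponent.isCompact.image continuous_subtype_val
  · exact isConnected_connectedComponent.image _ continuous_subtype_val.continuousOn
  · rintro _ ⟨z, -, rfl⟩; exact z.2
  intro hAN
  haveI : Nonempty { s : Set (K \ U : Set X) // IsClopen s ∧ x' ∈ s } :=
    ⟨⟨univ, isClopen_univ, mem_univ _⟩⟩
  obtain ⟨⟨s, hs, hxs⟩, hsU⟩ := exists_subset_nhds_of_isCompact'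
    (V := fun s : { s : Set (K \ U : Set X) // IsClopen s ∧ x' ∈ s } => s.1)
    (by
      rintro ⟨a, ha, ha'⟩ ⟨b, hb, hb'⟩
      exact ⟨⟨a ∩ b, ha.inter hb, ha', hb'⟩, inter_subset_left, inter_subset_right⟩)
    (fun s => s.2.1.1.isCompact) (fun s => s.2.1.1) (U := Subtype.val ⁻¹' (closure U)ᶜ)
    (by
      intro z hz
      rw [← connectedComponent_eq_iInter_isClopen] at hz
      refine (isClosed_closure.isOpen_compl.preimage continuous_subtype_val).mem_nhds ?_
      exact fun h => hUN.ne_of_mem h (hAN ⟨z, hz, rfl⟩) rfl)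
  have hS : IsClosed (Subtype.val '' s) := hF.isClosedEmbedding_subtypeVal.isClosedMap _ hs.1
  have hT : IsClosed (Subtype.val '' sᶜ) :=
    hF.isClosedEmbedding_subtypeVal.isClosedMap _ hs.compl.1
  have hsU' : ∀ z : (K \ U : Set X), z ∈ s → (z : X) ∉ closure U := fun z hz => hsU hz
  rcases (isPreconnected_iff_subset_of_fully_disjoint_closed hK.isClosed).1
        hKc.isPreconnected (Subtype.val '' s) ((Subtype.val '' sᶜ) ∪ closure U)
        hS (hT.union isClosed_closure) (by
          intro z hz
          by_cases hzU : z ∈ U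
          · exact Or.inr (Or.inr (subset_closure hzU))
          · by_cases h : (⟨z, hz, hzU⟩ : (K \ U : Set X)) ∈ s
            · exact Or.inl ⟨_, h, rfl⟩
            · exact Or.inr (Or.inl ⟨_, h, rfl⟩)) (by
          rw [Set.disjoint_left]
          rintro _ ⟨z, hz, rfl⟩ (⟨w, hw, hwz⟩ | h)
          · exact hw (Subtype.ext hwz ▸ hz)
          · exact hsU' z hz h) with h | h
  · obtain ⟨p, hpU, hpK⟩ := hUK
    obtain ⟨z, hz, rfl⟩ := h hpK
    exact z.2.2 hpU
  · rcases h hxK with ⟨w, hw, hwx⟩ | h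
    · exact hw ((Subtype.ext hwx : w = x') ▸ hxs)
    · exact hUN.ne_of_mem h hxN rfl

theorem closed_rel {F : Set X} (hF : IsClosed F) :
    IsClosed {p : X × X | ∃ C : Set X, IsCompact C ∧ IsConnected C ∧ C ⊆ F ∧
      p.1 ∈ C ∧ p.2 ∈ C} := by
  haveI : CompactSpace F := isCompact_iff_compactSpace.1 hF.isCompact
  have h : IsClosed {p : F × F | (p.1 : ConnectedComponents F) = p.2} :=
    isClosed_eq (ConnectedComponents.continuous_coe.comp continuous_fst)
      (ConnectedComponents.continuous_coe.comp continuous_snd)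
  have h2 := (hF.isClosedEmbedding_subtypeVal.prodMap hF.isClosedEmbedding_subtypeVal).isClosedMap
    _ h
  convert h2 using 1
  ext ⟨a, b⟩
  constructor
  · rintro ⟨C, hC, hCc, hCF, ha, hb⟩
    refine ⟨(⟨a, hCF ha⟩, ⟨b, hCF hb⟩), ?_, rfl⟩
    change ((⟨a, hCF ha⟩ : F) : ConnectedComponents F) = (⟨b, hCF hb⟩ : F)
    rw [ConnectedComponents.coe_eq_coe']
    have : IsPreconnected (Subtype.val ⁻¹' C : Set F) := by
      rw [← Topology.IsInducing.subtypeVal.isPreconnected_image, Subtype.image_preimage_coe,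
        inter_eq_right.2 hCF]
      exact hCc.isPreconnected
    exact this.subset_connectedComponent hb ha
  · rintro ⟨⟨u, v⟩, huv, h⟩
    have huv : (u : ConnectedComponents F) = v := huv
    rw [ConnectedComponents.coe_eq_coe'] at huv
    obtain ⟨rfl, rfl⟩ := Prod.ext_iff.1 h
    refine ⟨Subtype.val '' connectedComponent v,
      isClosed_connectedComponent.isCompact.image continuous_subtype_val,
      isConnected_connectedComponent.image _ continuous_subtype_val.continuousOn, ?_,
      ⟨u, huv, rfl⟩, ⟨v, mem_connectedComponent, rfl⟩⟩
    rintro _ ⟨z, -, rfl⟩; exact z.2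

theorem mc_connected [ConnectedSpace X] [Nontrivial X] (x : X) :
    x ∈ MeagerComposant X x ∧ IsConnected (MeagerComposant X x) := by
  have hx : x ∈ MeagerComposant X x :=
    ⟨{x}, ⟨isCompact_singleton, isConnected_singleton,
      isClosed_singleton.isNowhereDense_iff.2 (interior_singleton x), rfl⟩, rfl⟩
  exact ⟨hx, ⟨x, hx⟩, isPreconnected_sUnion x _ (fun s hs => hs.2.2.2)
    (fun s hs => hs.2.1.isPreconnected)⟩

theorem side [ConnectedSpace X] [Nontrivial X] (hX : HereditarilyUnicoherent X)
    (hclosed : ∀ x : X, IsClosed (MeagerComposant X x)) {x y : X} {K : Set X}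
    (hK : IsCompact K) (hKc : IsConnected K)
    (hirr : ∀ D : Set X, IsCompact D → IsConnected D → x ∈ D → y ∈ D → K ⊆ D)
    (hxK : x ∈ K) (hyK : y ∈ K) (hxy : y ∉ MeagerComposant X x) :
    interior (MeagerComposant X x ∩ K) = ∅ ∧
    ∀ U : Set X, IsOpen U → (U ∩ K).Nonempty → Disjoint (closure U) (MeagerComposant X x ∩ K) →
      ∃ A : Set X, IsCompact A ∧ IsConnected A ∧ x ∈ A ∧ A ⊆ K \ U ∧ (interior A).Nonempty := by
  obtain ⟨hx, hM⟩ := mc_connected x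
  have hMc := (hclosed x).isCompact
  refine ⟨interior_empty_aux hX hK hKc hirr hxK hyK (hMc.inter hK)
    ⟨⟨x, hx, hxK⟩, hX _ _ hMc hM hK hKc⟩ inter_subset_right ⟨hx, hxK⟩ (fun h => hxy h.1) ?_, ?_⟩
  · rintro z ⟨⟨L, ⟨h1, h2, h3, h4⟩, h5⟩, -⟩
    exact ⟨L, h1, h2, h3, h4, h5⟩
  · intro U hU hUK hdis
    obtain ⟨A, hA, hAc, hxA, hAK, hAN⟩ := boundary_bump (N := MeagerComposant X x ∩ K) hK hKc hxK ⟨hx, hxK⟩ hU hdis hUK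
    refine ⟨A, hA, hAc, hxA, hAK, ?_⟩
    by_contra hne
    rw [not_nonempty_iff_eq_empty] at hne
    exact hAN fun z hz =>
      ⟨⟨A, ⟨hA, hAc, hA.isClosed.isNowhereDense_iff.2 hne, hxA⟩, hz⟩, (hAK hz).1⟩

end Helpers

/-- If every meager composant of a hereditarily unicoherent continuum is closed, then the
relation "being in the same meager composant" is closed in `X × X`. -/
theorem meagerComposant_relation_closed (X : Type) [MetricSpace X] [CompactSpace X] [ConnectedSpace X] [Nonempty X]
    (hX : HereditarilyUnicoherent X)
    (hclosed : ∀ x : X, IsClosed (MeagerComposant X x)) :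
    IsClosed {p : X × X | p.2 ∈ MeagerComposant X p.1} := by
  rcases subsingleton_or_nontrivial X with hs | hnt
  · exact isClosed_discrete _
  rw [← isOpen_compl_iff, isOpen_iff_mem_nhds]
  rintro ⟨x, y⟩ hxy
  replace hxy : y ∉ MeagerComposant X x := hxy
  have hyx : x ∉ MeagerComposant X y := by
    rintro ⟨L, ⟨h1, h2, h3, h4⟩, h5⟩
    exact hxy ⟨L, ⟨h1, h2, h3, h5⟩, h4⟩
  obtain ⟨K, hK, hKc, hxK, hyK, hirr⟩ := exists_irreducible x y hX
  obtain ⟨hNx, hAx⟩ := side hX hclosed hK hKc hirr hxK hyK hxy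
  obtain ⟨hNy, hAy⟩ := side hX hclosed hK hKc (fun D h1 h2 h3 h4 => hirr D h1 h2 h4 h3)
    hyK hxK hyx
  have hNxc : IsClosed (MeagerComposant X x ∩ K) := (hclosed x).inter hK.isClosed
  have hNyc : IsClosed (MeagerComposant X y ∩ K) := (hclosed y).inter hK.isClosed
  have hN0 : interior ((MeagerComposant X x ∩ K) ∪ (MeagerComposant X y ∩ K)) = ∅ := by
    rw [interior_union_isClosed_of_interior_empty hNxc hNy, hNx]
  have hKint : (interior K).Nonempty := by
    by_contra hne
    rw [not_nonempty_iff_eq_empty] at hne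
    exact hxy ⟨K, ⟨hK, hKc, hK.isClosed.isNowhereDense_iff.2 hne, hxK⟩, hyK⟩
  obtain ⟨p, hpK, hpN⟩ : ∃ p ∈ interior K,
      p ∉ (MeagerComposant X x ∩ K) ∪ (MeagerComposant X y ∩ K) := by
    by_contra! hcon
    obtain ⟨w, hw⟩ := hKint
    have := interior_maximal hcon isOpen_interior hw
    rw [hN0] at this
    exact this
  obtain ⟨U, hU, hpU, hUcl⟩ : ∃ U : Set X, IsOpen U ∧ p ∈ U ∧ closure U ⊆ interior K ∩
      ((MeagerComposant X x ∩ K) ∪ (MeagerComposant X y ∩ K))ᶜ := by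
    have hO : IsOpen (interior K ∩
      ((MeagerComposant X x ∩ K) ∪ (MeagerComposant X y ∩ K))ᶜ) :=
      isOpen_interior.inter (hNxc.union hNyc).isOpen_compl
    obtain ⟨U, hU, h1, h2⟩ := normal_exists_closure_subset (isClosed_singleton (x := p)) hO
      (singleton_subset_iff.2 ⟨hpK, hpN⟩)
    exact ⟨U, hU, h1 rfl, h2⟩
  have hpUK : (U ∩ K).Nonempty := ⟨p, hpU, interior_subset hpK⟩
  obtain ⟨A, hA, hAc, hxA, hAK, P, hP⟩ := hAx U hU hpUK
    (Set.disjoint_left.2 fun z hz hz' => (hUcl hz).2 (Or.inl hz'))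
  obtain ⟨B, hB, hBc, hyB, hBK, Q, hQ⟩ := hAy U hU hpUK
    (Set.disjoint_left.2 fun z hz hz' => (hUcl hz).2 (Or.inr hz'))
  have hRA := (closed_rel (isOpen_interior (s := A)).isClosed_compl).isOpen_compl.mem_nhds
    (x := (x, y)) (by
      rintro ⟨C, hC, hCc, hCF, hxC, hyC⟩
      exact hCF (hirr C hC hCc hxC hyC (hAK (interior_subset hP)).1) hP)
  have hRB := (closed_rel (isOpen_interior (s := B)).isClosed_compl).isOpen_compl.mem_nhds
    (x := (x, y)) (by
      rintro ⟨C, hC, hCc, hCF, hxC, hyC⟩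
      exact hCF (hirr C hC hCc hxC hyC (hBK (interior_subset hQ)).1) hQ)
  filter_upwards [hRA, hRB]
  rintro ⟨a, b⟩ ha hb ⟨L, ⟨hL, hLc, hLn, haL⟩, hbL⟩
  obtain ⟨q, hqL, hqA⟩ : ∃ q ∈ L, q ∈ A := by
    by_contra! hcon
    exact ha ⟨L, hL, hLc, fun z hz h => hcon z hz (interior_subset h), haL, hbL⟩
  obtain ⟨r, hrL, hrB⟩ : ∃ q ∈ L, q ∈ B := by
    by_contra! hcon
    exact hb ⟨L, hL, hLc, fun z hz h => hcon z hz (interior_subset h), haL, hbL⟩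
  have hLK : IsConnected (L ∩ K) := ⟨⟨q, hqL, (hAK hqA).1⟩, hX L K hL hLc hK hKc⟩
  have h1 : IsConnected (A ∪ (L ∩ K)) :=
    IsConnected.union ⟨q, hqA, hqL, (hAK hqA).1⟩ hAc hLK
  have h2 : IsConnected ((A ∪ (L ∩ K)) ∪ B) :=
    IsConnected.union ⟨r, Or.inr ⟨hrL, (hBK hrB).1⟩, hrB⟩ h1 hBc
  have h3 := hirr _ ((hA.union (hL.inter hK)).union hB) h2 (Or.inl (Or.inl hxA)) (Or.inr hyB)
  have hUL : U ⊆ L := by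
    intro z hz
    rcases h3 (interior_subset (hUcl (subset_closure hz)).1) with (h | h) | h
    · exact absurd hz (hAK h).2
    · exact h.1
    · exact absurd hz (hBK h).2
  have := interior_maximal hUL hU hpU
  rw [hL.isClosed.isNowhereDense_iff.1 hLn] at this
  exact this
end

section
/- Let X be a hereditarily unicoherent continuum in which every indecomposable subcontinuum is nowhere dense. Then the partition of X into meager composants is upper semi-continuous, i.e., for every closed set A ⊂ X, the union of all meager composants meeting A is closed in X. -/
open Set Topology

/-- A subcontinuum of `X` (closed connected subset). -/
def SubCont {X : Type} [TopologicalSpace X] (K : Set X) : Prop := IsClosed K ∧ IsConnected K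

section helpers

variable {X : Type} [MetricSpace X] [CompactSpace X]

lemma SubCont.union {P Q : Set X} (hP : SubCont P) (hQ : SubCont Q) (h : (P ∩ Q).Nonempty) :
    SubCont (P ∪ Q) :=
  ⟨hP.1.union hQ.1, IsConnected.union h hP.2 hQ.2⟩

/-- The intersection of a nonempty chain of continua through `x` is a continuum. -/
lemma subCont_sInter {c : Set (Set X)} (hne : c.Nonempty) (hc : IsChain (· ⊆ ·) c)
    (h : ∀ s ∈ c, SubCont s) (x : X) (hx : ∀ s ∈ c, x ∈ s) : SubCont (⋂₀ c) := by
  have hcl : IsClosed (⋂₀ c) := isClosed_sInter fun s hs => (h s hs).1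
  refine ⟨hcl, ⟨x, hx⟩, ?_⟩
  rw [isPreconnected_iff_subset_of_fully_disjoint_closed hcl]
  intro a b ha hb hab hdis
  rcases normal_separation ha hb hdis with ⟨u, v, hu, hv, hau, hbv, huv⟩
  have : ∃ s ∈ c, s ⊆ u ∪ v := by
    haveI : Nonempty c := hne.to_subtype
    have := exists_subset_nhds_of_isCompact' (V := fun s : c => (s : Set X))
      (by
        intro s t
        rcases hc.total s.2 t.2 with h1 | h1
        · exact ⟨s, subset_rfl, h1⟩
        · exact ⟨t, h1, subset_rfl⟩)
      (fun s => (h s s.2).1.isCompact) (fun s => (h s s.2).1) (U := u ∪ v)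
      (by
        intro z hz
        apply (hu.union hv).mem_nhds
        have hz' : z ∈ ⋂₀ c := by
          rw [sInter_eq_iInter]; exact hz
        rcases hab hz' with h1 | h1
        · exact Or.inl (hau h1)
        · exact Or.inr (hbv h1))
    obtain ⟨s, hs⟩ := this
    exact ⟨s, s.2, hs⟩
  obtain ⟨s, hs, hsuv⟩ := this
  have hpre := isPreconnected_iff_subset_of_disjoint.1 (h s hs).2.isPreconnected u v hu hv hsuv
    (by rw [huv.inter_eq, inter_empty])
  rcases hpre with h1 | h1
  · left
    intro z hz
    rcases hab hz with h2 | h2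
    · exact h2
    · exact (disjoint_left.1 huv (h1 (hz s hs)) (hbv h2)).elim
  · right
    intro z hz
    rcases hab hz with h2 | h2
    · exact (disjoint_left.1 huv (hau h2) (h1 (hz s hs))).elim
    · exact h2

/-- Ultralimits of connected sets in a compact space are connected. -/
lemma ultralimit_preconnected {ι : Type} (U : Ultrafilter ι) (L : ι → Set X)
    (hL : ∀ᶠ i in (U : Filter ι), IsPreconnected (L i)) :
    IsClosed {z : X | ∀ V, IsOpen V → z ∈ V → ∀ᶠ i in (U : Filter ι), (L i ∩ V).Nonempty} ∧
    IsPreconnected {z : X | ∀ V, IsOpen V → z ∈ V → ∀ᶠ i in (U : Filter ι), (L i ∩ V).Nonempty} := by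
  set K := {z : X | ∀ V, IsOpen V → z ∈ V → ∀ᶠ i in (U : Filter ι), (L i ∩ V).Nonempty} with hK
  have hcl : IsClosed K := by
    rw [← isOpen_compl_iff, isOpen_iff_mem_nhds]
    intro z hz
    simp only [hK, mem_compl_iff, mem_setOf_eq, not_forall] at hz
    obtain ⟨V, hV, hzV, hn⟩ := hz
    filter_upwards [hV.mem_nhds hzV] with w hw hwK
    exact hn (hwK V hV hw)
  refine ⟨hcl, ?_⟩
  rw [isPreconnected_iff_subset_of_fully_disjoint_closed hcl]
  intro a b ha hb hab hdis
  rcases normal_separation ha hb hdis with ⟨u, v, hu, hv, hau, hbv, huv⟩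
  have hC : IsCompact (u ∪ v)ᶜ := (hu.union hv).isClosed_compl.isCompact
  have hev : ∀ᶠ i in (U : Filter ι), L i ⊆ u ∪ v := by
    have key : ∀ᶠ i in (U : Filter ι), L i ∩ (u ∪ v)ᶜ = ∅ := by
      refine hC.induction_on (p := fun s => ∀ᶠ i in (U : Filter ι), L i ∩ s = ∅) (by simp) ?_ ?_ ?_
      · intro s t hst ht
        filter_upwards [ht] with i hi
        exact subset_empty_iff.1 (hi ▸ inter_subset_inter_right _ hst)
      · intro s t hs ht
        filter_upwards [hs, ht] with i h1 h2
        rw [inter_union_distrib_left, h1, h2, union_empty]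
      · intro z hz
        have hzK : z ∉ K := fun h => hz ((union_subset_union hau hbv) (hab h))
        simp only [hK, mem_setOf_eq, not_forall] at hzK
        obtain ⟨V, hV, hzV, hn⟩ := hzK
        refine ⟨V, mem_nhdsWithin_of_mem_nhds (hV.mem_nhds hzV), ?_⟩
        rw [← Ultrafilter.eventually_not] at hn
        filter_upwards [hn] with i hi
        exact not_nonempty_iff_eq_empty.1 hi
    filter_upwards [key] with i hi z hz
    by_contra hzz
    exact (hi ▸ (⟨hz, hzz⟩ : z ∈ L i ∩ (u ∪ v)ᶜ) : z ∈ (∅ : Set X))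
  have hor : ∀ᶠ i in (U : Filter ι), L i ⊆ u ∨ L i ⊆ v := by
    filter_upwards [hev, hL] with i hi hp
    exact isPreconnected_iff_subset_of_disjoint.1 hp u v hu hv hi
      (by rw [huv.inter_eq, inter_empty])
  rw [Ultrafilter.eventually_or] at hor
  rcases hor with h1 | h1
  · left
    intro z hz
    rcases hab hz with h2 | h2
    · exact h2
    · obtain ⟨i, hi, hi'⟩ := (h1.and (hz v hv (hbv h2))).exists
      obtain ⟨w, hw1, hw2⟩ := hi'
      exact (disjoint_left.1 huv (hi hw1) hw2).elim
  · right
    intro z hz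
    rcases hab hz with h2 | h2
    · obtain ⟨i, hi, hi'⟩ := (h1.and (hz u hu (hau h2))).exists
      obtain ⟨w, hw1, hw2⟩ := hi'
      exact (disjoint_left.1 huv hw2 (hi hw1)).elim
    · exact h2

lemma union_part_connected {B P R₁ R₂ : Set X} (hB : SubCont B) (hP : SubCont P)
    (h₁ : IsClosed R₁) (h₂ : IsClosed R₂) (hd : Disjoint R₁ R₂)
    (hBe : B = P ∪ (R₁ ∪ R₂)) : SubCont (P ∪ R₁) := by
  have hcl : IsClosed (P ∪ R₁) := hP.1.union h₁
  refine ⟨hcl, hP.2.nonempty.mono subset_union_left, ?_⟩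
  rw [isPreconnected_iff_subset_of_fully_disjoint_closed hcl]
  have key : ∀ u v, IsClosed u → IsClosed v → P ∪ R₁ ⊆ u ∪ v → Disjoint u v → P ⊆ u →
      P ∪ R₁ ⊆ u := by
    intro u v hu hv huv hdis hPu
    have := isPreconnected_iff_subset_of_disjoint_closed.1 hB.2.isPreconnected
      (P ∪ R₂ ∪ (u ∩ R₁)) (v ∩ R₁) ((hP.1.union h₂).union (hu.inter h₁)) (hv.inter h₁)
      (by
        rw [hBe]
        rintro z (hz | hz | hz)
        · exact Or.inl (Or.inl (Or.inl hz))
        · rcases huv (Or.inr hz) with h | h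
          · exact Or.inl (Or.inr ⟨h, hz⟩)
          · exact Or.inr ⟨h, hz⟩
        · exact Or.inl (Or.inl (Or.inr hz)))
      (by
        rw [eq_empty_iff_forall_notMem]
        rintro z ⟨_, (( hz | hz) | hz), hz'⟩
        · exact disjoint_left.1 hdis (hPu hz) hz'.1
        · exact disjoint_left.1 hd hz'.2 hz
        · exact disjoint_left.1 hdis hz.1 hz'.1)
    obtain ⟨p, hp⟩ := hP.2.nonempty
    have hpB : P ⊆ B := hBe ▸ subset_union_left
    have hRB : R₁ ⊆ B := hBe ▸ (subset_union_left.trans subset_union_right)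
    rcases this with h | h
    · apply union_subset hPu
      intro z hz
      rcases h (hRB hz) with (h' | h') | h'
      · exact hPu h'
      · exact (disjoint_left.1 hd hz h').elim
      · exact h'.1
    · exact (disjoint_left.1 hdis (hPu hp) (h (hpB hp)).1).elim
  intro u v hu hv huv hdis
  have := (isPreconnected_iff_subset_of_fully_disjoint_closed hP.1).1 hP.2.isPreconnected u v hu hv
    (subset_union_left.trans huv) hdis
  rcases this with h | h
  · exact Or.inl (key u v hu hv huv hdis h)
  · exact Or.inr (key v u hv hu (by rwa [union_comm v u]) hdis.symm h)

lemma diff_connected_or {B P : Set X} (hB : SubCont B) (hP : SubCont P) (hPB : P ⊆ B)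
    (hne : P ≠ B) : SubCont (closure (B \ P)) ∨
      ∃ N₁ N₂, SubCont N₁ ∧ SubCont N₂ ∧ P ⊆ N₁ ∧ P ⊆ N₂ ∧ N₁ ∪ N₂ = B ∧ N₁ ≠ B ∧ N₂ ≠ B := by
  by_cases hc : SubCont (closure (B \ P))
  · exact Or.inl hc
  right
  have hnon : (closure (B \ P)).Nonempty := by
    apply Set.Nonempty.closure
    rw [diff_nonempty]
    exact fun h => hne (hPB.antisymm h)
  have hpre : ¬ IsPreconnected (closure (B \ P)) := fun h => hc ⟨isClosed_closure, hnon, h⟩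
  rw [isPreconnected_iff_subset_of_fully_disjoint_closed isClosed_closure] at hpre
  push Not at hpre
  obtain ⟨u, v, hu, hv, huv, hd, hnu, hnv⟩ := hpre
  set Q := closure (B \ P) with hQ
  have hQB : Q ⊆ B := closure_minimal diff_subset hB.1
  have hBe : B = P ∪ (u ∩ Q ∪ v ∩ Q) := by
    apply Subset.antisymm
    · intro z hz
      by_cases hzP : z ∈ P
      · exact Or.inl hzP
      · have hzQ : z ∈ Q := subset_closure ⟨hz, hzP⟩
        rcases huv hzQ with h | h
        · exact Or.inr (Or.inl ⟨h, hzQ⟩)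
        · exact Or.inr (Or.inr ⟨h, hzQ⟩)
    · exact union_subset hPB (union_subset (inter_subset_right.trans hQB)
        (inter_subset_right.trans hQB))
  have hd' : Disjoint (u ∩ Q) (v ∩ Q) := hd.mono inter_subset_left inter_subset_left
  have hcu := hu.inter (isClosed_closure (s := B \ P))
  have hcv := hv.inter (isClosed_closure (s := B \ P))
  have hneq : ∀ u, IsClosed u → ¬ Q ⊆ u → P ∪ u ∩ Q ≠ B := by
    intro u hu hn he
    apply hn
    apply closure_minimal _ hu
    rintro z ⟨hzB, hzP⟩
    rw [← he] at hzB
    rcases hzB with h | h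
    · exact (hzP h).elim
    · exact h.1
  refine ⟨P ∪ u ∩ Q, P ∪ v ∩ Q, union_part_connected hB hP hcu hcv hd' hBe,
    union_part_connected hB hP hcv hcu hd'.symm (by rw [union_comm (v ∩ Q)]; exact hBe),
    subset_union_left, subset_union_left, ?_, hneq u hu hnu, hneq v hv hnv⟩
  rw [← union_union_distrib_left]; exact hBe.symm

/-- One step of the argument that there is no minimal subcontinuum with interior through `x`. -/
lemma step {B P : Set X} {x : X}
    (hind : ∀ K : Set X, IsCompact K → IsConnected K → IndecomposableSet K → IsNowhereDense K)
    (hB : SubCont B) (hBi : (interior B).Nonempty)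
    (hmin : ∀ H, H ⊆ B → SubCont H → x ∈ H → (interior H).Nonempty → H = B)
    (hP : SubCont P) (hPB : P ⊆ B) (hxP : x ∈ P) (hPi : interior P = ∅) :
    Disjoint P (interior B) ∧ ∃ N, SubCont N ∧ P ⊆ N ∧ N ⊆ B ∧ interior N = ∅ ∧ ¬ N ⊆ P := by
  have hmin' : ∀ H, H ⊆ B → SubCont H → x ∈ H → H ≠ B → interior H = ∅ := by
    intro H h1 h2 h3 h4
    by_contra h5
    exact h4 (hmin H h1 h2 h3 (nonempty_iff_ne_empty.2 h5))
  have hPne : P ≠ B := by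
    rintro rfl
    exact hBi.ne_empty hPi
  have hQ : SubCont (closure (B \ P)) := by
    rcases diff_connected_or hB hP hPB hPne with h | ⟨N₁, N₂, h1, h2, h3, h4, h5, h6, h7⟩
    · exact h
    · exfalso
      have e1 := hmin' N₁ (h5 ▸ subset_union_left) h1 (h3 hxP) h6
      have e2 := hmin' N₂ (h5 ▸ subset_union_right) h2 (h4 hxP) h7
      have := interior_union_isClosed_of_interior_empty h1.1 e2
      rw [h5, e1] at this
      exact hBi.ne_empty this
  set Q := closure (B \ P) with hQdef
  have hQB : Q ⊆ B := closure_minimal diff_subset hB.1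
  have hBQ : B ⊆ P ∪ Q := by
    intro z hz
    by_cases hzP : z ∈ P
    · exact Or.inl hzP
    · exact Or.inr (subset_closure ⟨hz, hzP⟩)
  have hQi : (interior Q).Nonempty := by
    have : (interior B \ P).Nonempty := by
      rw [diff_nonempty]
      intro h
      have := interior_maximal h isOpen_interior
      rw [hPi, subset_empty_iff] at this
      exact hBi.ne_empty this
    refine this.mono (interior_maximal ?_ (isOpen_interior.sdiff hP.1))
    exact (diff_subset_diff_left interior_subset).trans subset_closure
  have hdec : ¬ IndecomposableSet Q := by
    intro h
    have := hind Q hQ.1.isCompact hQ.2 h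
    rw [hQ.1.isNowhereDense_iff] at this
    exact hQi.ne_empty this
  rw [IndecomposableSet, not_not] at hdec
  obtain ⟨H, K, hHc, hHcon, hKc, hKcon, hHQ, hKQ, hHne, hKne, hHK⟩ := hdec
  have hH : SubCont H := ⟨hHc.isClosed, hHcon⟩
  have hK : SubCont K := ⟨hKc.isClosed, hKcon⟩
  have small : ∀ H, SubCont H → H ⊆ Q → H ≠ Q → (P ∩ H).Nonempty → interior (P ∪ H) = ∅ := by
    intro H hH hHQ hHne hPH
    refine hmin' _ (union_subset hPB (hHQ.trans hQB)) (hP.union hH hPH) (Or.inl hxP) ?_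
    intro he
    apply hHne
    apply hHQ.antisymm
    apply closure_minimal _ hH.1
    rintro z ⟨hz, hzP⟩
    rw [← he] at hz
    exact hz.resolve_left hzP
  have hPQ : (P ∩ Q).Nonempty := by
    have := isPreconnected_closed_iff.1 hB.2.isPreconnected P Q hP.1 hQ.1 hBQ
      ⟨x, hPB hxP, hxP⟩ (hQ.2.nonempty.mono fun z hz => ⟨hQB hz, hz⟩)
    exact this.mono inter_subset_right
  have fin : ∀ H K, SubCont H → SubCont K → H ⊆ Q → K ⊆ Q → H ≠ Q → K ≠ Q → H ∪ K = Q →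
      (P ∩ H).Nonempty → 
      Disjoint P (interior B) ∧ ∃ N, SubCont N ∧ P ⊆ N ∧ N ⊆ B ∧ interior N = ∅ ∧ ¬ N ⊆ P := by
    intro H K hH hK hHQ hKQ hHne hKne hHK hPH
    have hi := small H hH hHQ hHne hPH
    have hcov : B ⊆ (P ∪ H) ∪ K := by
      intro z hz
      rcases hBQ hz with h | h
      · exact Or.inl (Or.inl h)
      · rw [← hHK] at h
        rcases h with h | h
        · exact Or.inl (Or.inr h)
        · exact Or.inr h
    have hPK : ¬ (P ∩ K).Nonempty := by
      intro h
      have hi2 := small K hK hKQ hKne h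
      have := interior_union_isClosed_of_interior_empty (hP.1.union hH.1) hi2
      rw [hi] at this
      have h3 : interior B ⊆ ∅ := by
        rw [← this]
        apply interior_mono
        exact hcov.trans (union_subset_union_right _ subset_union_right)
      exact hBi.ne_empty (subset_empty_iff.1 h3)
    have hBK : interior B ⊆ K := by
      intro z hz
      by_contra hzK
      have : interior B \ K ⊆ interior (P ∪ H) := by
        apply interior_maximal _ (isOpen_interior.sdiff hK.1)
        rintro w ⟨hw, hwK⟩
        exact (hcov (interior_subset hw)).resolve_right hwK
      rw [hi] at this
      exact this ⟨hz, hzK⟩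
    refine ⟨?_, P ∪ H, hP.union hH hPH, subset_union_left, union_subset hPB (hHQ.trans hQB), hi, ?_⟩
    · rw [disjoint_left]
      intro z hz hz'
      exact hPK ⟨z, hz, hBK hz'⟩
    · intro h
      apply hKne
      apply hKQ.antisymm
      apply closure_minimal _ hK.1
      rintro z ⟨hz, hzP⟩
      exact (hcov hz).resolve_left fun h' => hzP (h h')
  have hcase : (P ∩ H).Nonempty ∨ (P ∩ K).Nonempty := by
    obtain ⟨z, hzP, hzQ⟩ := hPQ
    rw [← hHK] at hzQ
    rcases hzQ with h | h
    · exact Or.inl ⟨z, hzP, h⟩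
    · exact Or.inr ⟨z, hzP, h⟩
  rcases hcase with h | h
  · exact fin H K hH hK hHQ hKQ hHne hKne hHK h
  · exact fin K H hK hH hKQ hHQ hKne hHne (by rwa [union_comm]) h

/-- There is no minimal subcontinuum with nonempty interior through `x`. -/
lemma no_minimal {B : Set X} {x : X}
    (hind : ∀ K : Set X, IsCompact K → IsConnected K → IndecomposableSet K → IsNowhereDense K)
    (hB : SubCont B) (hxB : x ∈ B) (hBi : (interior B).Nonempty)
    (hmin : ∀ H, H ⊆ B → SubCont H → x ∈ H → (interior H).Nonempty → H = B) : False := by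
  set F : Set (Set X) := {P | P ⊆ B ∧ SubCont P ∧ x ∈ P ∧ interior P = ∅} with hF
  have hxF : ({x} : Set X) ∈ F := by
    refine ⟨singleton_subset_iff.2 hxB, ⟨isClosed_singleton, isConnected_singleton⟩, rfl, ?_⟩
    rw [← isClosed_singleton.isNowhereDense_iff]
    apply hind _ isCompact_singleton isConnected_singleton
    rintro ⟨H, K, -, hH, -, -, hHx, -, hne, -⟩
    exact hne ((hH.nonempty.subset_singleton_iff).1 hHx)
  have hM : SubCont (closure (⋃₀ F)) :=
    ⟨isClosed_closure, ⟨x, subset_closure ⟨_, hxF, rfl⟩⟩,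
      (isPreconnected_sUnion x F (fun s hs => hs.2.2.1)
        (fun s hs => hs.2.1.2.isPreconnected)).closure⟩
  have hMB : closure (⋃₀ F) ⊆ B := closure_minimal (sUnion_subset fun s hs => hs.1) hB.1
  have hdis : Disjoint (closure (⋃₀ F)) (interior B) := by
    apply Disjoint.closure_left _ isOpen_interior
    rw [disjoint_sUnion_left]
    intro P hP
    exact (step hind hB hBi hmin hP.2.1 hP.1 hP.2.2.1 hP.2.2.2).1
  have hMi : interior (closure (⋃₀ F)) = ∅ := by
    rw [eq_empty_iff_forall_notMem]
    intro z hz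
    exact disjoint_left.1 hdis (interior_subset hz) (interior_mono hMB hz)
  have hxM : x ∈ closure (⋃₀ F) := subset_closure ⟨_, hxF, rfl⟩
  obtain ⟨-, N, hN, hMN, hNB, hNi, hnot⟩ := step hind hB hBi hmin hM hMB hxM hMi
  exact hnot ((subset_sUnion_of_mem (show N ∈ F from ⟨hNB, hN, hMN hxM, hNi⟩)).trans subset_closure)

/-- A chain of large continua through `x` with small intersection. -/
lemma exists_chain {I : Set X} {x : X}
    (hind : ∀ K : Set X, IsCompact K → IsConnected K → IndecomposableSet K → IsNowhereDense K)
    (hI : SubCont I) (hxI : x ∈ I) (hIi : (interior I).Nonempty) :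
    ∃ c : Set (Set X), IsChain (· ⊆ ·) c ∧
      (∀ H ∈ c, H ⊆ I ∧ SubCont H ∧ x ∈ H ∧ (interior H).Nonempty) ∧ interior (⋂₀ c) = ∅ := by
  by_contra hno
  push Not at hno
  obtain ⟨B, -, hBm⟩ := zorn_superset_nonempty
    {H : Set X | H ⊆ I ∧ SubCont H ∧ x ∈ H ∧ (interior H).Nonempty}
    (by
      intro c hcS hc hcne
      refine ⟨⋂₀ c, ⟨?_, subCont_sInter hcne hc (fun s hs => (hcS hs).2.1) x
        (fun s hs => (hcS hs).2.2.1), fun s hs => (hcS hs).2.2.1, ?_⟩,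
        fun s hs => sInter_subset_of_mem hs⟩
      · obtain ⟨s, hs⟩ := hcne
        exact (sInter_subset_of_mem hs).trans (hcS hs).1
      · have := hno c hc (fun H hH => hcS hH)
        first | exact this | exact nonempty_iff_ne_empty.2 this) I ⟨subset_rfl, hI, hxI, hIi⟩
  obtain ⟨hBI, hB, hxB, hBi⟩ := hBm.prop
  refine no_minimal hind hB hxB hBi fun H hHB hH hxH hHi => ?_
  exact hHB.antisymm (hBm.le_of_le ⟨hHB.trans hBI, hH, hxH, hHi⟩ hHB)

/-- The relation of lying in a common nowhere dense continuum is closed. -/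
lemma rel_closed (hX : HereditarilyUnicoherent X)
    (hind : ∀ K : Set X, IsCompact K → IsConnected K → IndecomposableSet K → IsNowhereDense K) :
    IsClosed {p : X × X | ∃ L : Set X, SubCont L ∧ interior L = ∅ ∧ p.1 ∈ L ∧ p.2 ∈ L} := by
  rw [isClosed_iff_ultrafilter]
  rintro ⟨x, y⟩ U hU hR
  by_contra hxy
  simp only [mem_setOf_eq, not_exists, not_and] at hxy
  have hR' : ∀ p : X × X, ∃ L : Set X,
      p ∈ {p : X × X | ∃ L : Set X, SubCont L ∧ interior L = ∅ ∧ p.1 ∈ L ∧ p.2 ∈ L} →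
      SubCont L ∧ interior L = ∅ ∧ p.1 ∈ L ∧ p.2 ∈ L := by
    intro p
    by_cases hp : p ∈ {p : X × X | ∃ L : Set X, SubCont L ∧ interior L = ∅ ∧ p.1 ∈ L ∧ p.2 ∈ L}
    · obtain ⟨L, hL⟩ := hp
      exact ⟨L, fun _ => hL⟩
    · exact ⟨∅, fun h => (hp h).elim⟩
  choose L hL using hR'
  have hLe : ∀ᶠ p in (U : Filter (X × X)),
      SubCont (L p) ∧ interior (L p) = ∅ ∧ p.1 ∈ L p ∧ p.2 ∈ L p := by
    filter_upwards [hR] with p hp using hL p hp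
  obtain ⟨hKcl, hKpre⟩ := ultralimit_preconnected U L
    (hLe.mono fun p hp => hp.1.2.isPreconnected)
  set K := {z : X | ∀ V, IsOpen V → z ∈ V → ∀ᶠ i in (U : Filter (X × X)), (L i ∩ V).Nonempty}
    with hK
  have hxK : x ∈ K := by
    intro V hV hxV
    have : ∀ᶠ p in (U : Filter (X × X)), p.1 ∈ V :=
      hU (continuous_fst.continuousAt.preimage_mem_nhds (hV.mem_nhds hxV))
    filter_upwards [hLe, this] with p hp hpV
    exact ⟨p.1, hp.2.2.1, hpV⟩
  have hyK : y ∈ K := by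
    intro V hV hyV
    have : ∀ᶠ p in (U : Filter (X × X)), p.2 ∈ V :=
      hU (continuous_snd.continuousAt.preimage_mem_nhds (hV.mem_nhds hyV))
    filter_upwards [hLe, this] with p hp hpV
    exact ⟨p.2, hp.2.2.2, hpV⟩
  -- minimal continuum from x to y inside K
  obtain ⟨I, hIK, hIm⟩ := zorn_superset_nonempty
    {H : Set X | SubCont H ∧ x ∈ H ∧ y ∈ H}
    (by
      intro c hcS hc hcne
      exact ⟨⋂₀ c, ⟨subCont_sInter hcne hc (fun s hs => (hcS hs).1) x
        (fun s hs => (hcS hs).2.1), fun s hs => (hcS hs).2.1, fun s hs => (hcS hs).2.2⟩,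
        fun s hs => sInter_subset_of_mem hs⟩) K ⟨⟨hKcl, ⟨x, hxK⟩, hKpre⟩, hxK, hyK⟩
  obtain ⟨hI, hxI, hyI⟩ := hIm.prop
  have hirr : ∀ H, H ⊆ I → SubCont H → x ∈ H → y ∈ H → H = I := fun H h1 h2 h3 h4 =>
    h1.antisymm (hIm.le_of_le ⟨h2, h3, h4⟩ h1)
  have hIi : (interior I).Nonempty := by
    rw [nonempty_iff_ne_empty]
    exact fun h => hxy I hI h hxI hyI
  obtain ⟨c, hc, hcp, hci⟩ := exists_chain hind hI hxI hIi
  have pick : ∀ G : Set X, IsOpen G → G.Nonempty → ∃ H ∈ c, ¬ G ⊆ H := by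
    intro G hG hGne
    by_contra hno
    push Not at hno
    have : G ⊆ interior (⋂₀ c) := interior_maximal (subset_sInter hno) hG
    rw [hci, subset_empty_iff] at this
    exact hGne.ne_empty this
  obtain ⟨H₁, hH₁c, hH₁⟩ := pick _ isOpen_interior hIi
  obtain ⟨hH₁I, hH₁s, hxH₁, hH₁i⟩ := hcp H₁ hH₁c
  obtain ⟨H₀, hH₀c, hH₀⟩ := pick _ isOpen_interior hH₁i
  obtain ⟨hH₀I, hH₀s, hxH₀, hH₀i⟩ := hcp H₀ hH₀c
  have hH₁ne : H₁ ≠ I := by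
    rintro rfl
    exact hH₁ interior_subset
  have hyH₁ : y ∉ H₁ := fun h => hH₁ne (hirr H₁ hH₁I hH₁s hxH₁ h)
  have hE : SubCont (closure (I \ H₁)) := by
    rcases diff_connected_or hI hH₁s hH₁I hH₁ne with h | ⟨N₁, N₂, h1, h2, h3, h4, h5, h6, h7⟩
    · exact h
    · exfalso
      have hy : y ∈ N₁ ∪ N₂ := h5 ▸ hyI
      rcases hy with hy | hy
      · exact h6 (hirr N₁ (h5 ▸ subset_union_left) h1 (h3 hxH₁) hy)
      · exact h7 (hirr N₂ (h5 ▸ subset_union_right) h2 (h4 hxH₁) hy)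
  set E := closure (I \ H₁) with hEdef
  have hEI : E ⊆ I := closure_minimal diff_subset hI.1
  have hyE : y ∈ E := subset_closure ⟨hyI, hyH₁⟩
  have hEi : (interior E).Nonempty := by
    have : (interior I \ H₁).Nonempty := diff_nonempty.2 hH₁
    refine this.mono (interior_maximal ?_ (isOpen_interior.sdiff hH₁s.1))
    exact (diff_subset_diff_left interior_subset).trans subset_closure
  have hWE : Disjoint (interior H₁) E := by
    refine Disjoint.closure_right ?_ isOpen_interior
    rw [disjoint_left]
    exact fun z hz hz' => hz'.2 (interior_subset hz)
  -- pick an index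
  obtain ⟨z₀, hz₀⟩ := hH₀i
  obtain ⟨z₁, hz₁⟩ := hEi
  have e0 := hIK (hH₀I (interior_subset hz₀)) _ isOpen_interior hz₀
  have e1 := hIK (hEI (interior_subset hz₁)) _ isOpen_interior hz₁
  obtain ⟨p, ⟨hLp, hLi, -, -⟩, ⟨a, haL, haH⟩, ⟨b, hbL, hbE⟩⟩ := (hLe.and (e0.and e1)).exists
  have haH' := interior_subset haH
  have hbE' := interior_subset hbE
  have hC : SubCont (L p ∩ I) := ⟨hLp.1.inter hI.1, ⟨a, haL, hH₀I haH'⟩,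
    hX _ _ hLp.1.isCompact hLp.2 hI.1.isCompact hI.2⟩
  have h1 : SubCont (H₀ ∪ (L p ∩ I)) := hH₀s.union hC ⟨a, haH', haL, hH₀I haH'⟩
  have h2 : SubCont (H₀ ∪ (L p ∩ I) ∪ E) := h1.union hE ⟨b, Or.inr ⟨hbL, hEI hbE'⟩, hbE'⟩
  have h3 := hirr _ (union_subset (union_subset hH₀I inter_subset_right) hEI) h2
    (Or.inl (Or.inl hxH₀)) (Or.inr hyE)
  have h4 : interior H₁ \ H₀ ⊆ interior (L p) := by
    apply interior_maximal _ (isOpen_interior.sdiff hH₀s.1)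
    rintro z ⟨hz, hzH⟩
    have hzI : z ∈ I := hH₁I (interior_subset hz)
    rw [← h3] at hzI
    rcases hzI with (h | h) | h
    · exact (hzH h).elim
    · exact h.1
    · exact (disjoint_left.1 hWE hz h).elim
  rw [hLi, subset_empty_iff] at h4
  exact (diff_nonempty.2 hH₀).ne_empty h4

end helpers

/-- If every indecomposable subcontinuum of a hereditarily unicoherent continuum is
nowhere dense, then the decomposition into meager composants is upper semi-continuous. -/
theorem meagerComposants_upper_semicontinuous (X : Type) [MetricSpace X] [CompactSpace X] [ConnectedSpace X] [Nonempty X]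
    (hX : HereditarilyUnicoherent X)
    (hind : ∀ K : Set X, IsCompact K → IsConnected K → IndecomposableSet K →
      IsNowhereDense K) :
    ∀ A : Set X, IsClosed A → IsClosed (⋃ x ∈ A, MeagerComposant X x) := by
  intro A hA
  have hR := rel_closed hX hind
  have hEq : (⋃ x ∈ A, MeagerComposant X x) = Prod.snd ''
      ({p : X × X | ∃ L : Set X, SubCont L ∧ interior L = ∅ ∧ p.1 ∈ L ∧ p.2 ∈ L} ∩
        Prod.fst ⁻¹' A) := by
    ext y
    simp only [MeagerComposant, mem_iUnion, mem_sUnion, mem_setOf_eq, mem_image, mem_inter_iff,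
      mem_preimage]
    constructor
    · rintro ⟨x, hx, L, ⟨h1, h2, h3, h4⟩, h5⟩
      exact ⟨(x, y), ⟨⟨L, ⟨h1.isClosed, h2⟩, h1.isClosed.isNowhereDense_iff.1 h3, h4, h5⟩, hx⟩, rfl⟩
    · rintro ⟨⟨x, y'⟩, ⟨⟨L, h1, h2, h3, h4⟩, hx⟩, rfl⟩
      exact ⟨x, hx, L, ⟨h1.1.isCompact, h1.2, h1.1.isNowhereDense_iff.2 h2, h3⟩, h4⟩
  rw [hEq]
  exact ((hR.inter (hA.preimage continuous_fst)).isCompact.image continuous_snd).isClosed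
end
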